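/- arXiv:2206.08203 — 3 statements merged into one kernel-verified Lean document; each statement's English description precedes it below -/
import Mathlib

section
/- There exists a continuous function f : [0,1] → [0,∞) with f(δ) → 0 as δ → 0⁺, such that for every δ ∈ (0,1) and all points (ξ₁,μ₁), (ξ₂,μ₂) ∈ A_δ satisfying ξ₁ξ₂ < 0 and μ₁μ₂ < 0, one has h(ξ₁+ξ₂, μ₁+μ₂) ≤ |h(ξ₁,μ₁) − h(ξ₂,μ₂)| + f(δ) · max{h(ξ₁,μ₁), h(ξ₂,μ₂)}. -/
noncomputable section

/-- `h(ξ,μ) = 3ξ² + μ²`. -/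
def hZK (ξ μ : ℝ) : ℝ := 3 * ξ ^ 2 + μ ^ 2

/-- `A_δ = {(ξ,μ) : (3−δ)ξ² ≤ μ² ≤ (3+δ)ξ²}`. -/
def Adelta (δ : ℝ) : Set (ℝ × ℝ) :=
  {p : ℝ × ℝ | (3 - δ) * p.1 ^ 2 ≤ p.2 ^ 2 ∧ p.2 ^ 2 ≤ (3 + δ) * p.1 ^ 2}

/-- For vectors of `A_δ` in opposite quadrants, `-⟨·,·⟩` in the quadratic form `h` nearly dominates
the smaller of the two values of `h`. -/
theorem two_mul_le_of_mem_Adelta {δ ξ₁ μ₁ ξ₂ μ₂ m : ℝ} (h₀ : 0 < δ) (h₁ : δ < 1)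
    (hA₁ : (ξ₁, μ₁) ∈ Adelta δ) (hA₂ : (ξ₂, μ₂) ∈ Adelta δ)
    (hξ : ξ₁ * ξ₂ < 0) (hμ : μ₁ * μ₂ < 0) (hm : 0 ≤ m)
    (hm₁ : m ≤ hZK ξ₁ μ₁) (hm₂ : m ≤ hZK ξ₂ μ₂) :
    2 * m ≤ -2 * (3 * (ξ₁ * ξ₂) + μ₁ * μ₂) + δ * m := by
  obtain ⟨hl₁, hu₁⟩ := hA₁
  obtain ⟨hl₂, hu₂⟩ := hA₂
  simp only [hZK] at *
  have hb : (3 - δ) * -(ξ₁ * ξ₂) ≤ -(μ₁ * μ₂) := by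
    refine le_of_abs_le <| abs_le_of_sq_le_sq ?_ (by linarith)
    have := mul_le_mul hl₁ hl₂ (by have := sq_nonneg ξ₂; nlinarith) (sq_nonneg μ₁)
    linarith
  have ha : m ≤ (6 + δ) * -(ξ₁ * ξ₂) := by
    refine le_of_abs_le <| abs_le_of_sq_le_sq ?_ (by nlinarith)
    have h₁' : m ≤ (6 + δ) * ξ₁ ^ 2 := by linarith
    have h₂' : m ≤ (6 + δ) * ξ₂ ^ 2 := by linarith
    have := mul_le_mul h₁' h₂' hm (by positivity)
    linarith
  obtain ⟨q, rfl⟩ : ∃ q, m = (6 + δ) * q := ⟨m / (6 + δ), by field_simp⟩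
  have hq : 0 ≤ q := nonneg_of_mul_nonneg_right hm (by linarith)
  have hqa : q ≤ -(ξ₁ * ξ₂) := le_of_mul_le_mul_left ha (by linarith)
  have := mul_le_mul_of_nonneg_left hqa (by linarith : 0 ≤ 6 - δ)
  nlinarith [mul_nonneg (mul_nonneg h₀.le hq) (by linarith : 0 ≤ 2 + δ)]

theorem stmt5 :
    ∃ f : ℝ → ℝ,
      ContinuousOn f (Set.Icc 0 1) ∧
      (∀ δ ∈ Set.Icc (0 : ℝ) 1, 0 ≤ f δ) ∧
      Filter.Tendsto f (nhdsWithin 0 (Set.Ioi 0)) (nhds 0) ∧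
      ∀ δ ∈ Set.Ioo (0 : ℝ) 1, ∀ ξ₁ μ₁ ξ₂ μ₂ : ℝ,
        (ξ₁, μ₁) ∈ Adelta δ → (ξ₂, μ₂) ∈ Adelta δ →
        ξ₁ * ξ₂ < 0 → μ₁ * μ₂ < 0 →
        hZK (ξ₁ + ξ₂) (μ₁ + μ₂) ≤
          |hZK ξ₁ μ₁ - hZK ξ₂ μ₂| + f δ * max (hZK ξ₁ μ₁) (hZK ξ₂ μ₂) := by
  refine ⟨fun δ => δ, continuousOn_id, fun δ hδ => hδ.1,
    tendsto_nhdsWithin_of_tendsto_nhds Filter.tendsto_id, ?_⟩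
  rintro δ ⟨h₀, h₁⟩ ξ₁ μ₁ ξ₂ μ₂ hA₁ hA₂ hξ hμ
  have hn₁ : 0 ≤ hZK ξ₁ μ₁ := by unfold hZK; positivity
  have hn₂ : 0 ≤ hZK ξ₂ μ₂ := by unfold hZK; positivity
  have key := two_mul_le_of_mem_Adelta h₀ h₁ hA₁ hA₂ hξ hμ (le_min hn₁ hn₂)
    (min_le_left _ _) (min_le_right _ _)
  have hadd : hZK (ξ₁ + ξ₂) (μ₁ + μ₂) =
      hZK ξ₁ μ₁ + hZK ξ₂ μ₂ + 2 * (3 * (ξ₁ * ξ₂) + μ₁ * μ₂) := by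
    unfold hZK; ring
  have hmm := mul_le_mul_of_nonneg_left
    (min_le_max (a := hZK ξ₁ μ₁) (b := hZK ξ₂ μ₂)) h₀.le
  have habs := max_sub_min_eq_abs (hZK ξ₁ μ₁) (hZK ξ₂ μ₂)
  rw [abs_sub_comm] at habs
  have hsum := min_add_max (hZK ξ₁ μ₁) (hZK ξ₂ μ₂)
  linarith
end
end

section
/- There is a universal constant C > 0 with the following property. Let A > 0 and let g : ℝ → ℂ be a differentiable function satisfying |g(x)| ≤ A(1+|x|)^{−4} and |g′(x)| ≤ A(1+|x|)^{−4} for all x ∈ ℝ. Then for every M > 0 and all τ, τ̃, a ∈ ℝ with τ̃ ≠ a, one has | g(M^{−1}(τ − τ̃)) − g(M^{−1}(τ − a)) | · ((τ̃ − a)² + M²)^{1/2} / |τ̃ − a| ≤ C · A · [ (1 + M^{−1}|τ − τ̃|)^{−4} + (1 + M^{−1}|τ − a|)^{−4} ]. -/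
noncomputable section

/-- A function which decays like `(1 + |x|)⁻⁴` together with its derivative has increments bounded
by `min (1, |x - y|)` times the decay weight at the endpoints. -/
lemma norm_sub_mul_one_add_le {A : ℝ} (hA : 0 < A) {g : ℝ → ℂ} (hg : Differentiable ℝ g)
    (hg0 : ∀ x : ℝ, ‖g x‖ ≤ A / (1 + |x|) ^ 4)
    (hg1 : ∀ x : ℝ, ‖deriv g x‖ ≤ A / (1 + |x|) ^ 4) (x y : ℝ) :
    ‖g x - g y‖ * (1 + |x - y|) ≤
      32 * A * (((1 + |x|) ^ 4)⁻¹ + ((1 + |y|) ^ 4)⁻¹) * |x - y| := by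
  have hX : 0 < ((1 + |x|) ^ 4)⁻¹ := by positivity
  have hY : 0 < ((1 + |y|) ^ 4)⁻¹ := by positivity
  rcases le_total 1 |x - y| with h | h
  · have h1 : ‖g x - g y‖ ≤ A * (((1 + |x|) ^ 4)⁻¹ + ((1 + |y|) ^ 4)⁻¹) := by
      calc ‖g x - g y‖ ≤ ‖g x‖ + ‖g y‖ := norm_sub_le _ _
        _ ≤ A / (1 + |x|) ^ 4 + A / (1 + |y|) ^ 4 := add_le_add (hg0 x) (hg0 y)
        _ = _ := by simp only [div_eq_mul_inv]; ring
    calc ‖g x - g y‖ * (1 + |x - y|)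
        ≤ A * (((1 + |x|) ^ 4)⁻¹ + ((1 + |y|) ^ 4)⁻¹) * (32 * |x - y|) := by
          gcongr
          linarith
      _ = _ := by ring
  · have hderiv : ∀ z ∈ Metric.closedBall x 1, ‖deriv g z‖ ≤ 16 * A * ((1 + |x|) ^ 4)⁻¹ := by
      intro z hz
      rw [Metric.mem_closedBall, Real.dist_eq, abs_sub_comm] at hz
      have hxz : |x| ≤ |z| + 1 := by linarith [abs_sub_abs_le_abs_sub x z]
      have hz0 := abs_nonneg z
      calc ‖deriv g z‖ ≤ A / (1 + |z|) ^ 4 := hg1 z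
        _ ≤ A / ((1 + |x|) / 2) ^ 4 := by
          gcongr
          linarith
        _ = _ := by field_simp; norm_num
    have hy : y ∈ Metric.closedBall x 1 := by
      rwa [Metric.mem_closedBall, Real.dist_eq, abs_sub_comm]
    have h1 : ‖g x - g y‖ ≤ 16 * A * ((1 + |x|) ^ 4)⁻¹ * |x - y| :=
      (convex_closedBall x 1).norm_image_sub_le_of_norm_deriv_le (fun z _ => hg z) hderiv hy
        (Metric.mem_closedBall_self zero_le_one)
    calc ‖g x - g y‖ * (1 + |x - y|)
        ≤ 16 * A * ((1 + |x|) ^ 4)⁻¹ * |x - y| * 2 := by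
          gcongr
          linarith
      _ = 32 * A * ((1 + |x|) ^ 4)⁻¹ * |x - y| := by ring
      _ ≤ _ := by
          gcongr
          linarith

theorem stmt8 :
    ∃ C : ℝ, 0 < C ∧
      ∀ A : ℝ, 0 < A →
      ∀ g : ℝ → ℂ, Differentiable ℝ g →
        (∀ x : ℝ, ‖g x‖ ≤ A / (1 + |x|) ^ 4) →
        (∀ x : ℝ, ‖deriv g x‖ ≤ A / (1 + |x|) ^ 4) →
        ∀ M : ℝ, 0 < M → ∀ τ τt a : ℝ, τt ≠ a →
          ‖g (M⁻¹ * (τ - τt)) - g (M⁻¹ * (τ - a))‖ *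
              Real.sqrt ((τt - a) ^ 2 + M ^ 2) / |τt - a| ≤
            C * A * (((1 + M⁻¹ * |τ - τt|) ^ 4)⁻¹ + ((1 + M⁻¹ * |τ - a|) ^ 4)⁻¹) := by
  refine ⟨32, by norm_num, fun A hA g hg hg0 hg1 M hM τ τt a hne => ?_⟩
  have hd : 0 < |τt - a| := abs_pos.mpr (sub_ne_zero.mpr hne)
  have habs (t : ℝ) : |M⁻¹ * t| = M⁻¹ * |t| := by
    rw [abs_mul, abs_of_pos (inv_pos.mpr hM)]
  have hsub : |M⁻¹ * (τ - τt) - M⁻¹ * (τ - a)| = M⁻¹ * |τt - a| := by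
    rw [← mul_sub, habs, sub_sub_sub_cancel_left, abs_sub_comm]
  have key := norm_sub_mul_one_add_le hA hg hg0 hg1 (M⁻¹ * (τ - τt)) (M⁻¹ * (τ - a))
  rw [hsub, habs, habs] at key
  have hsqrt : Real.sqrt ((τt - a) ^ 2 + M ^ 2) ≤ M * (1 + M⁻¹ * |τt - a|) := by
    rw [mul_add, mul_one, mul_inv_cancel_left₀ hM.ne']
    refine Real.sqrt_le_iff.mpr ⟨by positivity, ?_⟩
    nlinarith [sq_abs (τt - a), mul_pos hM hd]
  rw [div_le_iff₀ hd]
  calc ‖g (M⁻¹ * (τ - τt)) - g (M⁻¹ * (τ - a))‖ * Real.sqrt ((τt - a) ^ 2 + M ^ 2)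
      ≤ ‖g (M⁻¹ * (τ - τt)) - g (M⁻¹ * (τ - a))‖ * (M * (1 + M⁻¹ * |τt - a|)) := by
        gcongr
    _ = M * (‖g (M⁻¹ * (τ - τt)) - g (M⁻¹ * (τ - a))‖ * (1 + M⁻¹ * |τt - a|)) := by ring
    _ ≤ M * _ := mul_le_mul_of_nonneg_left key hM.le
    _ = _ := by rw [mul_left_comm, mul_inv_cancel_left₀ hM.ne']
end
end

section
/- There exists a constant C > 0 such that for every Schwartz function u₀ on ℝ², the function F(t,x,y) := (2π)^{−2} ∫_{ℝ²} e^{i(xξ + yμ + tξ(ξ²+μ²))} |3ξ² − μ²|^{1/8} û₀(ξ,μ) dξ dμ satisfies ‖F‖_{L⁴(ℝ³)} ≤ C ‖u₀‖_{L²(ℝ²)}. -/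
open MeasureTheory

noncomputable section

/-- The Fourier transform on ℝ². -/
def ftn2 (u : ℝ × ℝ → ℂ) (p : ℝ × ℝ) : ℂ :=
  ∫ q : ℝ × ℝ, Complex.exp (-(Complex.I * (q.1 * p.1 + q.2 * p.2))) * u q

/-- Substituting `v = x p² + c` on a half line. -/
theorem lintegral_mul_comp_sq_le {x : ℝ} (hx : x ≠ 0) (c : ℝ) (ψ : ℝ → ENNReal) :
    ∫⁻ p in Set.Ioi (0 : ℝ), ENNReal.ofReal p * ψ (x * p ^ 2 + c) ≤
      ENNReal.ofReal (1 / (2 * |x|)) * ∫⁻ v, ψ v := by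
  have hx' : 0 < |x| := abs_pos.2 hx
  have h1 : ∀ p ∈ Set.Ioi (0 : ℝ),
      HasDerivWithinAt (fun p : ℝ => x * p ^ 2 + c) (x * (2 * p)) (Set.Ioi 0) p := by
    intro p _
    have := (((hasDerivAt_id p).pow 2).const_mul x).add_const c
    simpa using this.hasDerivWithinAt
  have h2 : Set.InjOn (fun p : ℝ => x * p ^ 2 + c) (Set.Ioi 0) := by
    intro p hp q hq h
    have hp' : (0 : ℝ) < p := hp
    have hq' : (0 : ℝ) < q := hq
    have : p ^ 2 = q ^ 2 := by
      apply mul_left_cancel₀ hx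
      simpa using h
    exact (pow_left_inj₀ hp'.le hq'.le two_ne_zero).1 this
  have h3 := lintegral_image_eq_lintegral_abs_deriv_mul measurableSet_Ioi h1 h2 ψ
  have h4 : ∫⁻ p in Set.Ioi (0 : ℝ), ENNReal.ofReal p * ψ (x * p ^ 2 + c) =
      ENNReal.ofReal (1 / (2 * |x|)) *
        ∫⁻ p in Set.Ioi (0 : ℝ), ENNReal.ofReal |x * (2 * p)| * ψ (x * p ^ 2 + c) := by
    rw [← lintegral_const_mul' _ _ ENNReal.ofReal_ne_top]
    refine setLIntegral_congr_fun measurableSet_Ioi fun p hp => ?_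
    have hp' : (0 : ℝ) < p := hp
    rw [← mul_assoc, ← ENNReal.ofReal_mul (by positivity), abs_mul, abs_of_pos (by positivity : 0 < 2 * p)]
    congr 2
    field_simp
  rw [h4, ← h3]
  gcongr
  exact Measure.restrict_le_self

/-- One half of the box estimate: the second coordinate is confined to an interval whose
length depends only on the level. -/
theorem setLIntegral_fst_le {x y : ℝ} (hx : x ≠ 0) {K : ℝ → ENNReal} (hK : Measurable K)
    {a b : ℝ → ℝ} (ha : Measurable a) (hb : Measurable b) {M : ℝ}
    (hab : ∀ v, ENNReal.ofReal (a v) * ENNReal.ofReal (2 * b v) ≤ ENNReal.ofReal M)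
    {q₀ : ℝ} {E : Set (ℝ × ℝ)} (hE : MeasurableSet E)
    (h : ∀ z ∈ E, 0 < z.1 ∧ |z.2 - q₀| ≤ b (x * z.1 ^ 2 + y * z.2 ^ 2)) :
    ∫⁻ z in E, ENNReal.ofReal (a (x * z.1 ^ 2 + y * z.2 ^ 2)) * ENNReal.ofReal z.1 *
        K (x * z.1 ^ 2 + y * z.2 ^ 2) ≤
      ENNReal.ofReal (1 / (2 * |x|)) * (ENNReal.ofReal M * ∫⁻ v, K v) := by
  set B : Set (ℝ × ℝ) := {w | |w.2 - q₀| ≤ b w.1} with hB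
  have hBm : MeasurableSet B := by
    apply measurableSet_le
    · fun_prop
    · fun_prop
  set ψ : ℝ → ℝ → ENNReal := fun q v =>
    B.indicator (fun w => ENNReal.ofReal (a w.1) * K w.1) (v, q) with hψ
  have hψm : Measurable (Function.uncurry ψ) := by
    have : Measurable (B.indicator (fun w : ℝ × ℝ => ENNReal.ofReal (a w.1) * K w.1)) :=
      Measurable.indicator (by fun_prop) hBm
    exact this.comp measurable_swap
  calc _ = ∫⁻ z, E.indicator (fun z => ENNReal.ofReal (a (x * z.1 ^ 2 + y * z.2 ^ 2)) * ENNReal.ofReal z.1 *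
        K (x * z.1 ^ 2 + y * z.2 ^ 2)) z := (lintegral_indicator hE _).symm
    _ ≤ ∫⁻ z : ℝ × ℝ, (Set.Ioi (0:ℝ)).indicator
          (fun p => ENNReal.ofReal p * ψ z.2 (x * p ^ 2 + y * z.2 ^ 2)) z.1 := by
        refine lintegral_mono fun z => ?_
        by_cases hz : z ∈ E
        · obtain ⟨h1, h2⟩ := h z hz
          have : (x * z.1 ^ 2 + y * z.2 ^ 2, z.2) ∈ B := h2
          simp only [Set.indicator_of_mem hz, Set.indicator_of_mem (Set.mem_Ioi.2 h1), hψ,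
            Set.indicator_of_mem this]
          apply le_of_eq
          ring
        · simp [Set.indicator_of_notMem hz]
    _ = ∫⁻ q : ℝ, ∫⁻ p in Set.Ioi (0:ℝ), ENNReal.ofReal p * ψ q (x * p ^ 2 + y * q ^ 2) := by
        rw [Measure.volume_eq_prod, lintegral_prod_symm']
        · simp only [lintegral_indicator measurableSet_Ioi]
        · have h0 : Measurable (fun z : ℝ × ℝ => ENNReal.ofReal z.1 * ψ z.2 (x * z.1 ^ 2 + y * z.2 ^ 2)) := by
            apply Measurable.mul (by fun_prop)
            exact hψm.comp (by fun_prop : Measurable fun z : ℝ × ℝ => (z.2, x * z.1 ^ 2 + y * z.2 ^ 2))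
          have := h0.indicator (measurable_fst measurableSet_Ioi : MeasurableSet ((Prod.fst : ℝ × ℝ → ℝ) ⁻¹' Set.Ioi 0))
          exact this
    _ ≤ ∫⁻ q : ℝ, ENNReal.ofReal (1 / (2 * |x|)) * ∫⁻ v, ψ q v :=
        lintegral_mono fun q => lintegral_mul_comp_sq_le hx _ _
    _ = ENNReal.ofReal (1 / (2 * |x|)) * ∫⁻ v, ∫⁻ q, ψ q v := by
        rw [lintegral_const_mul' _ _ ENNReal.ofReal_ne_top, lintegral_lintegral_swap hψm.aemeasurable]
    _ ≤ _ := by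
        gcongr
        rw [← lintegral_const_mul' _ _ ENNReal.ofReal_ne_top]
        refine lintegral_mono fun v => ?_
        have : ∀ q, ψ q v = (Metric.closedBall q₀ (b v)).indicator
            (fun _ => ENNReal.ofReal (a v) * K v) q := by
          intro q
          simp only [hψ, hB, Set.indicator, Set.mem_ofPred_eq, Metric.mem_closedBall, Real.dist_eq]
        simp only [this]
        rw [lintegral_indicator Metric.isClosed_closedBall.measurableSet, setLIntegral_const,
          Real.volume_closedBall, mul_right_comm]
        gcongr
        exact hab v

theorem setLIntegral_sqrt_mul_le_of_box {x y : ℝ} (hx : x ≠ 0) (hy : y ≠ 0) {K : ℝ → ENNReal}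
    (hK : Measurable K) {ℓ : ℝ → ℝ} (hℓ : Measurable ℓ) {W : ℝ} (hW : 0 < W) {p₀ q₀ : ℝ}
    {E : Set (ℝ × ℝ)} (hE : MeasurableSet E)
    (h : ∀ z ∈ E, 0 < z.1 ∧ 0 < z.2 ∧ 0 < ℓ (x * z.1 ^ 2 + y * z.2 ^ 2) ∧
      |z.1 - p₀| ≤ ℓ (x * z.1 ^ 2 + y * z.2 ^ 2) ∧
      |z.2 - q₀| ≤ W / ℓ (x * z.1 ^ 2 + y * z.2 ^ 2)) :
    ∫⁻ z in E, ENNReal.ofReal (√(z.1 * z.2)) * K (x * z.1 ^ 2 + y * z.2 ^ 2) ≤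
      ENNReal.ofReal (√(W / |x * y|)) * ∫⁻ v, K v := by
  have hx' : 0 < |x| := abs_pos.2 hx
  have hy' : 0 < |y| := abs_pos.2 hy
  set c : ℝ := √(|x| / (|y| * W)) with hc
  have hcp : 0 < c := by positivity
  have hcW : c * W / |x| = √(W / |x * y|) := by
    rw [abs_mul, eq_comm, Real.sqrt_eq_iff_mul_self_eq (by positivity) (by positivity)]
    have : c * c = |x| / (|y| * W) := Real.mul_self_sqrt (by positivity)
    symm
    calc c * W / |x| * (c * W / |x|) = (c * c) * W ^ 2 / |x| ^ 2 := by ring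
      _ = _ := by rw [this]; field_simp
  have hcy : 1 / (c * |y|) = √(W / |x * y|) := by
    rw [← hcW]
    have : c * c = |x| / (|y| * W) := Real.mul_self_sqrt (by positivity)
    rw [div_eq_div_iff (by positivity) (by positivity)]
    calc 1 * |x| = (|x| / (|y| * W)) * (W * |y|) := by field_simp
      _ = _ := by rw [← this]; ring
  have e1 := setLIntegral_fst_le (y := y) (q₀ := q₀) hx hK (a := fun v => c * ℓ v) (b := fun v => W / ℓ v)
    (by fun_prop) (by fun_prop) (M := 2 * c * W) (fun v => by
      rcases le_or_gt (ℓ v) 0 with h0 | h0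
      · rw [ENNReal.ofReal_of_nonpos (by nlinarith)]; simp
      · rw [← ENNReal.ofReal_mul (by positivity)]
        apply ENNReal.ofReal_le_ofReal
        apply le_of_eq
        field_simp) hE (fun z hz => ⟨(h z hz).1, (h z hz).2.2.2.2⟩)
  have e2 := setLIntegral_fst_le (x := y) (y := x) (q₀ := p₀) hy hK (a := fun v => 1 / (c * ℓ v))
    (b := ℓ)
    (by fun_prop) (by fun_prop) (M := 2 / c) (fun v => by
      rcases le_or_gt (ℓ v) 0 with h0 | h0
      · rw [ENNReal.ofReal_of_nonpos (p := 2 * ℓ v) (by nlinarith)]; simp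
      · rw [← ENNReal.ofReal_mul (by positivity)]
        apply ENNReal.ofReal_le_ofReal
        apply le_of_eq
        field_simp) (E := Prod.swap ⁻¹' E) (measurable_swap hE)
      (fun z hz => by
        have := h z.swap hz
        simp only [Prod.fst_swap, Prod.snd_swap] at this
        rw [add_comm] at this
        exact ⟨this.2.1, this.2.2.2.1⟩)
  have e3 : ∫⁻ z in Prod.swap ⁻¹' E, ENNReal.ofReal (1 / (c * ℓ (y * z.1 ^ 2 + x * z.2 ^ 2))) * ENNReal.ofReal z.1 *
        K (y * z.1 ^ 2 + x * z.2 ^ 2) = ∫⁻ z in E, ENNReal.ofReal (1 / (c * ℓ (x * z.1 ^ 2 + y * z.2 ^ 2))) * ENNReal.ofReal z.2 *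
        K (x * z.1 ^ 2 + y * z.2 ^ 2) := by
    have hmp : MeasurePreserving (Prod.swap : ℝ × ℝ → ℝ × ℝ) volume volume :=
      Measure.measurePreserving_swap
    rw [← hmp.setLIntegral_comp_preimage hE (by fun_prop)]
    simp only [Prod.fst_swap, Prod.snd_swap]
    simp only [add_comm]
  rw [e3] at e2
  calc _ ≤ ∫⁻ z in E, (ENNReal.ofReal (1 / 2) * (ENNReal.ofReal (c * ℓ (x * z.1 ^ 2 + y * z.2 ^ 2)) * ENNReal.ofReal z.1 *
        K (x * z.1 ^ 2 + y * z.2 ^ 2)) + ENNReal.ofReal (1 / 2) * (ENNReal.ofReal (1 / (c * ℓ (x * z.1 ^ 2 + y * z.2 ^ 2))) * ENNReal.ofReal z.2 *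
        K (x * z.1 ^ 2 + y * z.2 ^ 2))) := by
        refine setLIntegral_mono (by fun_prop) fun z hz => ?_
        obtain ⟨h1, h2, h3, -, -⟩ := h z hz
        simp only [← mul_assoc]
        rw [← add_mul]
        gcongr
        rw [← ENNReal.ofReal_mul (by positivity), ← ENNReal.ofReal_mul (by positivity),
          ← ENNReal.ofReal_mul (by positivity), ← ENNReal.ofReal_mul (by positivity),
          ← ENNReal.ofReal_add (by positivity) (by positivity)]
        apply ENNReal.ofReal_le_ofReal
        set d := c * ℓ (x * z.1 ^ 2 + y * z.2 ^ 2)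
        have hd : 0 < d := by positivity
        rw [Real.sqrt_le_left (by positivity)]
        have : z.1 * z.2 = (d * z.1) * (1 / d * z.2) := by field_simp
        rw [this]
        nlinarith [sq_nonneg (d * z.1 - 1 / d * z.2)]
    _ ≤ ENNReal.ofReal (1 / 2) * (ENNReal.ofReal (1 / (2 * |x|)) * (ENNReal.ofReal (2 * c * W) * ∫⁻ v, K v)) +
        ENNReal.ofReal (1 / 2) * (ENNReal.ofReal (1 / (2 * |y|)) * (ENNReal.ofReal (2 / c) * ∫⁻ v, K v)) := by
        rw [lintegral_add_left (by fun_prop), lintegral_const_mul' _ _ ENNReal.ofReal_ne_top,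
          lintegral_const_mul' _ _ ENNReal.ofReal_ne_top]
        gcongr
    _ = _ := by
        simp only [← mul_assoc]
        rw [← add_mul, ← ENNReal.ofReal_mul (by positivity), ← ENNReal.ofReal_mul (by positivity),
          ← ENNReal.ofReal_mul (by positivity), ← ENNReal.ofReal_mul (by positivity),
          ← ENNReal.ofReal_add (by positivity) (by positivity)]
        congr 2
        calc _ = 1 / 2 * (c * W / |x|) + 1 / 2 * (1 / (c * |y|)) := by field_simp
          _ = _ := by rw [hcW, hcy]; ring

/-- The scale at which `x |p² - p₀²|` reaches size `u`. -/
theorem level_scale {x p₀ p u : ℝ} (hx : 0 < x) (hp₀ : 0 < p₀) (hp : 0 < p) (hne : p ≠ p₀)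
    (h1 : x * |p ^ 2 - p₀ ^ 2| ≤ 2 * u) (h2 : u ≤ 2 * (x * |p ^ 2 - p₀ ^ 2|)) :
    0 < min (√(2 * u / x)) (2 * u / (p₀ * x)) ∧
      |p - p₀| ≤ min (√(2 * u / x)) (2 * u / (p₀ * x)) ∧
      min (√(2 * u / x)) (2 * u / (p₀ * x)) ≤ 16 * |p - p₀| := by
  set s := |p - p₀| with hs
  have hs0 : 0 < s := abs_pos.2 (sub_ne_zero.2 hne)
  have hf : |p ^ 2 - p₀ ^ 2| = s * (p + p₀) := by
    rw [show p ^ 2 - p₀ ^ 2 = (p - p₀) * (p + p₀) by ring, abs_mul, abs_of_pos (by linarith : 0 < p + p₀)]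
  have hs1 : s ≤ p + p₀ := abs_le.2 ⟨by linarith, by linarith⟩
  have hs2 : p + p₀ ≤ s + 2 * p₀ := by linarith [le_abs_self (p - p₀)]
  rw [hf] at h1 h2
  have hu : 0 < u := by
    have : 0 < x * (s * (p + p₀)) := by positivity
    linarith
  refine ⟨lt_min (by positivity) (by positivity), le_min ?_ ?_, ?_⟩
  · apply Real.le_sqrt_of_sq_le
    rw [le_div_iff₀ hx]
    nlinarith [mul_le_mul_of_nonneg_left hs1 (mul_pos hx hs0).le]
  · rw [le_div_iff₀ (by positivity)]
    nlinarith [mul_pos (mul_pos hx hs0) hp]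
  · rcases le_total (2 * p₀) s with h | h
    · refine (min_le_left _ _).trans ?_
      rw [Real.sqrt_le_left (by positivity), div_le_iff₀ hx]
      nlinarith [mul_le_mul_of_nonneg_left (hs2.trans (by linarith : s + 2 * p₀ ≤ 2 * s)) (mul_pos hx hs0).le,
        mul_pos hx (mul_pos hs0 hs0)]
    · refine (min_le_right _ _).trans ?_
      rw [div_le_iff₀ (by positivity)]
      nlinarith [mul_le_mul_of_nonneg_left (hs2.trans (by linarith : s + 2 * p₀ ≤ 4 * p₀)) (mul_pos hx hs0).le]

/-- The point of the hyperbola `s s' = Z` where the two increasing profiles agree. -/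
theorem exists_balanced_scale {X Y Z p₀ q₀ : ℝ} (hX : 0 < X) (hY : 0 < Y) (hZ : 0 < Z)
    (hp₀ : 0 < p₀) (hq₀ : 0 < q₀) :
    ∃ ℓ : ℝ, 0 < ℓ ∧ X * (ℓ * max ℓ p₀) = Y * (Z / ℓ * max (Z / ℓ) q₀) := by
  set h : ℝ → ℝ := fun ℓ => X * (ℓ * max ℓ p₀) - Y * (Z / ℓ * max (Z / ℓ) q₀) with hh
  set l₁ := min 1 (Y * Z * q₀ / (X * (1 + p₀))) with hl₁
  set l₂ := max Z (Y * (1 + q₀) / (X * p₀)) with hl₂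
  have p1 : 0 < l₁ := by positivity
  have p2 : 0 < l₂ := by positivity
  have n1 : h l₁ ≤ 0 := by
    have a1 : l₁ ≤ 1 := min_le_left _ _
    have a2 : l₁ * (X * (1 + p₀)) ≤ Y * Z * q₀ := by
      rw [← le_div_iff₀ (by positivity)]; exact min_le_right _ _
    have a3 : max l₁ p₀ ≤ 1 + p₀ := max_le (by linarith) (by linarith)
    have a4 : X * (l₁ * max l₁ p₀) ≤ X * (1 * (1 + p₀)) := by gcongr
    have a5 : Y * (Z / l₁ * q₀) ≤ Y * (Z / l₁ * max (Z / l₁) q₀) := by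
      gcongr; exact le_max_right _ _
    have a6 : X * (1 + p₀) ≤ Y * (Z / l₁ * q₀) := by
      rw [show Y * (Z / l₁ * q₀) = Y * Z * q₀ / l₁ by ring, le_div_iff₀ p1]; linarith
    simp only [hh]; linarith
  have n2 : 0 ≤ h l₂ := by
    have a1 : Z / l₂ ≤ 1 := (div_le_one p2).2 (le_max_left _ _)
    have a2 : Y * (1 + q₀) ≤ l₂ * (X * p₀) := by
      rw [← div_le_iff₀ (by positivity)]; exact le_max_right _ _
    have a3 : max (Z / l₂) q₀ ≤ 1 + q₀ := max_le (by linarith) (by linarith)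
    have a4 : Y * (Z / l₂ * max (Z / l₂) q₀) ≤ Y * (1 * (1 + q₀)) := by gcongr
    have a5 : X * (l₂ * p₀) ≤ X * (l₂ * max l₂ p₀) := by
      gcongr; exact le_max_right _ _
    simp only [hh]; linarith
  have hsub : Set.uIcc l₁ l₂ ⊆ Set.Ioi 0 := by
    intro t ht
    rw [Set.mem_uIcc] at ht
    rcases ht with ht | ht
    · exact p1.trans_le ht.1
    · exact p2.trans_le ht.1
  have hcont : ContinuousOn h (Set.uIcc l₁ l₂) := by
    have : ContinuousOn (fun t : ℝ => Z / t) (Set.uIcc l₁ l₂) :=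
      continuousOn_const.div continuousOn_id fun t ht => (hsub ht).ne'
    simp only [hh]
    fun_prop
  obtain ⟨ℓ, hℓ, h0⟩ := intermediate_value_uIcc hcont (Set.mem_uIcc.2 (Or.inl ⟨n1, n2⟩))
  exact ⟨ℓ, hsub hℓ, by simp only [hh] at h0; linarith⟩

theorem profile_bounds {p p₀ : ℝ} (hp : 0 < p) (hp₀ : 0 < p₀) :
    |p - p₀| * max |p - p₀| p₀ ≤ |p ^ 2 - p₀ ^ 2| ∧
      |p ^ 2 - p₀ ^ 2| ≤ 3 * (|p - p₀| * max |p - p₀| p₀) := by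
  have hf : |p ^ 2 - p₀ ^ 2| = |p - p₀| * (p + p₀) := by
    rw [show p ^ 2 - p₀ ^ 2 = (p - p₀) * (p + p₀) by ring, abs_mul, abs_of_pos (by linarith : 0 < p + p₀)]
  have hs1 : |p - p₀| ≤ p + p₀ := abs_le.2 ⟨by linarith, by linarith⟩
  have hs2 : p + p₀ ≤ |p - p₀| + 2 * p₀ := by linarith [le_abs_self (p - p₀)]
  rw [hf]
  constructor
  · gcongr
    exact max_le hs1 (by linarith)
  · rw [show 3 * (|p - p₀| * max |p - p₀| p₀) = |p - p₀| * (3 * max |p - p₀| p₀) by ring]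
    gcongr
    linarith [le_max_left |p - p₀| p₀, le_max_right |p - p₀| p₀]

theorem le_mul_of_profile_le {s t r c : ℝ} (hc : 1 ≤ c) (ht : 0 ≤ t) (hr : 0 < r)
    (h : s * max s r ≤ c * (t * max t r)) : s ≤ c * t := by
  by_contra! hlt
  have h1 : t ≤ c * t := by nlinarith
  have h2 : max t r ≤ max s r := max_le_max (by linarith) le_rfl
  have h3 : 0 < max t r := lt_max_of_lt_right hr
  have h4 : c * t * max t r < s * max s r :=
    mul_lt_mul hlt h2 h3 (by nlinarith)
  linarith

/-- The balanced part of a level set lies in a box independent of the level. -/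
theorem balanced_box {X Y Z p₀ q₀ ℓ p q : ℝ} (hX : 0 < X) (hY : 0 < Y) (hZ : 0 < Z)
    (hp₀ : 0 < p₀) (hq₀ : 0 < q₀) (hp : 0 < p) (hq : 0 < q) (hℓ : 0 < ℓ)
    (hbal : X * (ℓ * max ℓ p₀) = Y * (Z / ℓ * max (Z / ℓ) q₀))
    (hpq : |p - p₀| * |q - q₀| ≤ Z)
    (h1 : X * |p ^ 2 - p₀ ^ 2| ≤ 2 * (Y * |q ^ 2 - q₀ ^ 2|))
    (h2 : Y * |q ^ 2 - q₀ ^ 2| ≤ 2 * (X * |p ^ 2 - p₀ ^ 2|)) :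
    |p - p₀| ≤ 6 * ℓ ∧ |q - q₀| ≤ 36 * Z / (6 * ℓ) := by
  obtain ⟨a1, a2⟩ := profile_bounds hp hp₀
  obtain ⟨b1, b2⟩ := profile_bounds hq hq₀
  set s := |p - p₀| with hs
  set t := |q - q₀| with ht
  have hs0 : 0 ≤ s := abs_nonneg _
  have ht0 : 0 ≤ t := abs_nonneg _
  have hT : 0 < Z / ℓ := by positivity
  rw [show 36 * Z / (6 * ℓ) = 6 * (Z / ℓ) by field_simp; ring]
  rcases le_total s ℓ with h | h
  · refine ⟨by linarith, le_mul_of_profile_le (r := q₀) (by norm_num) hT.le hq₀ ?_⟩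
    have c1 : s * max s p₀ ≤ ℓ * max ℓ p₀ := by gcongr
    have : Y * (t * max t q₀) ≤ Y * (6 * (Z / ℓ * max (Z / ℓ) q₀)) := by
      calc Y * (t * max t q₀) ≤ Y * |q ^ 2 - q₀ ^ 2| := by gcongr
        _ ≤ 2 * (X * |p ^ 2 - p₀ ^ 2|) := h2
        _ ≤ 2 * (X * (3 * (ℓ * max ℓ p₀))) := by gcongr; linarith
        _ = _ := by linear_combination 6 * hbal
    exact le_of_mul_le_mul_left this hY
  · have ht1 : t ≤ Z / ℓ := by
      rw [le_div_iff₀ hℓ]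
      nlinarith
    refine ⟨le_mul_of_profile_le (r := p₀) (by norm_num) hℓ.le hp₀ ?_, by linarith⟩
    have c1 : t * max t q₀ ≤ Z / ℓ * max (Z / ℓ) q₀ := by gcongr
    have : X * (s * max s p₀) ≤ X * (6 * (ℓ * max ℓ p₀)) := by
      calc X * (s * max s p₀) ≤ X * |p ^ 2 - p₀ ^ 2| := by gcongr
        _ ≤ 2 * (Y * |q ^ 2 - q₀ ^ 2|) := h1
        _ ≤ 2 * (Y * (3 * (Z / ℓ * max (Z / ℓ) q₀))) := by gcongr; linarith
        _ = _ := by linear_combination -6 * hbal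
    exact le_of_mul_le_mul_left this hX

theorem setLIntegral_sqrt_mul_le {x y : ℝ} (hx : x ≠ 0) (hy : y ≠ 0) {K : ℝ → ENNReal}
    (hK : Measurable K) {Z p₀ q₀ : ℝ} (hZ : 0 < Z) (hp₀ : 0 < p₀) (hq₀ : 0 < q₀) :
    ∫⁻ z in {z : ℝ × ℝ | 0 < z.1 ∧ 0 < z.2 ∧ |z.1 - p₀| * |z.2 - q₀| ≤ Z},
        ENNReal.ofReal (√(z.1 * z.2)) * K (x * z.1 ^ 2 + y * z.2 ^ 2) ≤
      3 * (ENNReal.ofReal (√(36 * Z / |x * y|)) * ∫⁻ v, K v) := by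
  have hx' : 0 < |x| := abs_pos.2 hx
  have hy' : 0 < |y| := abs_pos.2 hy
  set v₀ := x * p₀ ^ 2 + y * q₀ ^ 2 with hv₀
  set f : ℝ × ℝ → ℝ := fun z => |x| * |z.1 ^ 2 - p₀ ^ 2| with hf
  set g : ℝ × ℝ → ℝ := fun z => |y| * |z.2 ^ 2 - q₀ ^ 2| with hg
  set u : ℝ × ℝ → ℝ := fun z => |x * z.1 ^ 2 + y * z.2 ^ 2 - v₀| with hu
  set E : Set (ℝ × ℝ) := {z | 0 < z.1 ∧ 0 < z.2 ∧ |z.1 - p₀| * |z.2 - q₀| ≤ Z} with hE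
  set N : Set (ℝ × ℝ) := {z | z.1 ≠ p₀ ∧ z.2 ≠ q₀} with hN
  set P₁ : Set (ℝ × ℝ) := {z | f z ≤ 2 * u z ∧ u z ≤ 2 * f z} with hP₁
  set P₂ : Set (ℝ × ℝ) := {z | g z ≤ 2 * u z ∧ u z ≤ 2 * g z} with hP₂
  set P₃ : Set (ℝ × ℝ) := {z | f z ≤ 2 * g z ∧ g z ≤ 2 * f z} with hP₃
  have mf : Measurable f := by fun_prop
  have mg : Measurable g := by fun_prop
  have mu : Measurable u := by fun_prop
  have mE : MeasurableSet E := by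
    have h3 : MeasurableSet {z : ℝ × ℝ | |z.1 - p₀| * |z.2 - q₀| ≤ Z} :=
      measurableSet_le (by fun_prop) measurable_const
    exact (measurableSet_lt measurable_const measurable_fst).inter
      ((measurableSet_lt measurable_const measurable_snd).inter h3)
  have mN : MeasurableSet N :=
    ((measurableSet_eq_fun measurable_fst measurable_const).compl).inter
      ((measurableSet_eq_fun measurable_snd measurable_const).compl)
  have m₁ : MeasurableSet P₁ :=
    (measurableSet_le mf (by fun_prop)).inter (measurableSet_le mu (by fun_prop))
  have m₂ : MeasurableSet P₂ :=
    (measurableSet_le mg (by fun_prop)).inter (measurableSet_le mu (by fun_prop))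
  have m₃ : MeasurableSet P₃ :=
    (measurableSet_le mf (by fun_prop)).inter (measurableSet_le mg (by fun_prop))
  have hNae : ∀ᵐ z : ℝ × ℝ, z ∈ N := by
    have h1 : ∀ᵐ z : ℝ × ℝ, z.1 ≠ p₀ :=
      Measure.quasiMeasurePreserving_fst.ae (p := fun t => t ≠ p₀) (Measure.ae_ne volume p₀)
    have h2 : ∀ᵐ z : ℝ × ℝ, z.2 ≠ q₀ :=
      Measure.quasiMeasurePreserving_snd.ae (p := fun t => t ≠ q₀) (Measure.ae_ne volume q₀)
    filter_upwards [h1, h2] with z a b using ⟨a, b⟩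
  have htri : ∀ z, u z ≤ f z + g z ∧ f z ≤ u z + g z ∧ g z ≤ u z + f z := by
    intro z
    have e : x * z.1 ^ 2 + y * z.2 ^ 2 - v₀ = x * (z.1 ^ 2 - p₀ ^ 2) + y * (z.2 ^ 2 - q₀ ^ 2) := by
      rw [hv₀]; ring
    simp only [hf, hg, hu, e, ← abs_mul]
    set a := x * (z.1 ^ 2 - p₀ ^ 2)
    set b := y * (z.2 ^ 2 - q₀ ^ 2)
    refine ⟨abs_add_le a b, ?_, ?_⟩
    · have := abs_sub (a + b) b; simpa using this
    · have := abs_sub (a + b) a; simpa using this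
  have hcover : E ∩ N ⊆ (E ∩ N ∩ P₁) ∪ (E ∩ N ∩ P₂) ∪ (E ∩ N ∩ P₃) := by
    intro z hz
    obtain ⟨t1, t2, t3⟩ := htri z
    have f0 : 0 ≤ f z := by positivity
    have g0 : 0 ≤ g z := by positivity
    by_cases h3 : z ∈ P₃
    · exact Or.inr ⟨hz, h3⟩
    · rcases le_total (f z) (g z) with h | h
      · have : 2 * f z < g z := by
          by_contra! hc
          exact h3 ⟨by linarith, hc⟩
        exact Or.inl (Or.inr ⟨hz, by linarith, by linarith⟩)
      · have : 2 * g z < f z := by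
          by_contra! hc
          exact h3 ⟨hc, by linarith⟩
        exact Or.inl (Or.inl ⟨hz, by linarith, by linarith⟩)
  set F : ℝ × ℝ → ENNReal := fun z => ENNReal.ofReal (√(z.1 * z.2)) * K (x * z.1 ^ 2 + y * z.2 ^ 2) with hF
  have w1 : √(16 * Z / |x * y|) ≤ √(36 * Z / |x * y|) := by
    apply Real.sqrt_le_sqrt
    gcongr
    norm_num
  have b₁ : ∫⁻ z in E ∩ N ∩ P₁, F z ≤ ENNReal.ofReal (√(36 * Z / |x * y|)) * ∫⁻ v, K v := by
    refine (setLIntegral_sqrt_mul_le_of_box (W := 16 * Z) (p₀ := p₀) (q₀ := q₀) hx hy hK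
      (ℓ := fun v => min (√(2 * |v - v₀| / |x|)) (2 * |v - v₀| / (p₀ * |x|)))
      (by fun_prop) (by positivity) ((mE.inter mN).inter m₁) ?_).trans ?_
    · rintro z ⟨⟨⟨h1, h2, h3⟩, h4, h5⟩, h6, h7⟩
      obtain ⟨c1, c2, c3⟩ := level_scale hx' hp₀ h1 h4 h6 h7
      refine ⟨h1, h2, c1, c2, ?_⟩
      rw [le_div_iff₀ c1]
      calc |z.2 - q₀| * _ ≤ |z.2 - q₀| * (16 * |z.1 - p₀|) := by gcongr
        _ ≤ 16 * Z := by linarith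
    · gcongr
  have b₂ : ∫⁻ z in E ∩ N ∩ P₂, F z ≤ ENNReal.ofReal (√(36 * Z / |x * y|)) * ∫⁻ v, K v := by
    refine (setLIntegral_sqrt_mul_le_of_box (W := 16 * Z) (p₀ := p₀) (q₀ := q₀) hx hy hK
      (ℓ := fun v => 16 * Z / min (√(2 * |v - v₀| / |y|)) (2 * |v - v₀| / (q₀ * |y|)))
      (by fun_prop) (by positivity) ((mE.inter mN).inter m₂) ?_).trans ?_
    · rintro z ⟨⟨⟨h1, h2, h3⟩, h4, h5⟩, h6, h7⟩
      obtain ⟨c1, c2, c3⟩ := level_scale hy' hq₀ h2 h5 h6 h7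
      refine ⟨h1, h2, by positivity, ?_, ?_⟩
      · rw [le_div_iff₀ c1]
        calc |z.1 - p₀| * _ ≤ |z.1 - p₀| * (16 * |z.2 - q₀|) := by gcongr
          _ ≤ 16 * Z := by linarith
      · rw [div_div_cancel₀ (by positivity)]
        exact c2
    · gcongr
  have b₃ : ∫⁻ z in E ∩ N ∩ P₃, F z ≤ ENNReal.ofReal (√(36 * Z / |x * y|)) * ∫⁻ v, K v := by
    obtain ⟨ℓ, hℓ, hbal⟩ := exists_balanced_scale hx' hy' hZ hp₀ hq₀
    refine setLIntegral_sqrt_mul_le_of_box (W := 36 * Z) (p₀ := p₀) (q₀ := q₀) hx hy hK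
      (ℓ := fun _ => 6 * ℓ) (by fun_prop) (by positivity) ((mE.inter mN).inter m₃) ?_
    rintro z ⟨⟨⟨h1, h2, h3⟩, h4, h5⟩, h6, h7⟩
    obtain ⟨c1, c2⟩ := balanced_box hx' hy' hZ hp₀ hq₀ h1 h2 hℓ hbal h3 h6 h7
    exact ⟨h1, h2, by positivity, c1, c2⟩
  calc ∫⁻ z in E, F z = ∫⁻ z in E ∩ N, F z := by
        apply setLIntegral_congr
        filter_upwards [hNae] with z hz
        exact propext ⟨fun h => ⟨h, hz⟩, fun h => h.1⟩
    _ ≤ ∫⁻ z in (E ∩ N ∩ P₁) ∪ (E ∩ N ∩ P₂) ∪ (E ∩ N ∩ P₃), F z := lintegral_mono_set hcover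
    _ ≤ ((∫⁻ z in E ∩ N ∩ P₁, F z) + ∫⁻ z in E ∩ N ∩ P₂, F z) + ∫⁻ z in E ∩ N ∩ P₃, F z :=
        (lintegral_union_le _ _ _).trans (add_le_add_left (lintegral_union_le _ _ _) _)
    _ ≤ _ := by
        refine (add_le_add (add_le_add b₁ b₂) b₃).trans (le_of_eq ?_)
        ring

/-- The phase, a sum of two cubic phases. -/
def cubicPhase (d₁ d₂ : ℝ) (p : ℝ × ℝ) : ℝ := d₁ * p.1 ^ 3 + d₂ * p.2 ^ 3

/-- The kernel of the bilinear form in the pair `(p, p + x)`, with `A = 2 p + x`. -/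
def pairKernel (d₁ d₂ : ℝ) (K : ℝ → ENNReal) (A x y : ℝ × ℝ) : ENNReal :=
  {y : ℝ × ℝ | 0 < A.1 + 2 * y.1 ∧ 0 < A.2 + 2 * y.2 ∧ |y.1| * |y.2| ≤ |x.1 * x.2|}.indicator
    (fun y => ENNReal.ofReal (√((A.1 + 2 * y.1) * (A.2 + 2 * y.2))) *
      K (3 * d₁ * x.1 * (y.1 * (A.1 + y.1)) + 3 * d₂ * x.2 * (y.2 * (A.2 + y.2)))) y

theorem measurable_pairKernel (d₁ d₂ : ℝ) {K : ℝ → ENNReal} (hK : Measurable K) :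
    Measurable fun z : (ℝ × ℝ) × (ℝ × ℝ) × (ℝ × ℝ) => pairKernel d₁ d₂ K z.1 z.2.1 z.2.2 := by
  have hS : MeasurableSet {z : (ℝ × ℝ) × (ℝ × ℝ) × (ℝ × ℝ) | 0 < z.1.1 + 2 * z.2.2.1 ∧
      0 < z.1.2 + 2 * z.2.2.2 ∧ |z.2.2.1| * |z.2.2.2| ≤ |z.2.1.1 * z.2.1.2|} := by
    have h1 : MeasurableSet {z : (ℝ × ℝ) × (ℝ × ℝ) × (ℝ × ℝ) | 0 < z.1.1 + 2 * z.2.2.1} :=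
      measurableSet_lt (by fun_prop) (by fun_prop)
    have h2 : MeasurableSet {z : (ℝ × ℝ) × (ℝ × ℝ) × (ℝ × ℝ) | 0 < z.1.2 + 2 * z.2.2.2} :=
      measurableSet_lt (by fun_prop) (by fun_prop)
    have h3 : MeasurableSet {z : (ℝ × ℝ) × (ℝ × ℝ) × (ℝ × ℝ) |
        |z.2.2.1| * |z.2.2.2| ≤ |z.2.1.1 * z.2.1.2|} :=
      measurableSet_le (by fun_prop) (by fun_prop)
    exact h1.inter (h2.inter h3)
  have h := Measurable.indicator (f := fun z : (ℝ × ℝ) × (ℝ × ℝ) × (ℝ × ℝ) =>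
    ENNReal.ofReal (√((z.1.1 + 2 * z.2.2.1) * (z.1.2 + 2 * z.2.2.2))) *
      K (3 * d₁ * z.2.1.1 * (z.2.2.1 * (z.1.1 + z.2.2.1)) +
        3 * d₂ * z.2.1.2 * (z.2.2.2 * (z.1.2 + z.2.2.2)))) (by fun_prop) hS
  exact h

theorem lintegral_pairKernel_le {d₁ d₂ : ℝ} (hd₁ : d₁ ≠ 0) (hd₂ : d₂ ≠ 0) {K : ℝ → ENNReal}
    (hK : Measurable K) {A x : ℝ × ℝ} (hA₁ : 0 < A.1) (hA₂ : 0 < A.2) (hx₁ : x.1 ≠ 0) (hx₂ : x.2 ≠ 0) :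
    ∫⁻ y, pairKernel d₁ d₂ K A x y ≤
      6 * ENNReal.ofReal (√(4 / |d₁ * d₂|)) * ∫⁻ v, K v := by
  have hZ : 0 < |x.1 * x.2| := abs_pos.2 (mul_ne_zero hx₁ hx₂)
  set S : Set (ℝ × ℝ) := {z : ℝ × ℝ | 0 < z.1 ∧ 0 < z.2 ∧ |z.1 - A.1 / 2| * |z.2 - A.2 / 2| ≤ |x.1 * x.2|}
    with hS
  have mS : MeasurableSet S := by
    have h3 : MeasurableSet {z : ℝ × ℝ | |z.1 - A.1 / 2| * |z.2 - A.2 / 2| ≤ |x.1 * x.2|} :=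
      measurableSet_le (by fun_prop) measurable_const
    exact (measurableSet_lt measurable_const measurable_fst).inter
      ((measurableSet_lt measurable_const measurable_snd).inter h3)
  set c : ℝ := -(3 * d₁ * x.1 * (A.1 ^ 2 / 4) + 3 * d₂ * x.2 * (A.2 ^ 2 / 4)) with hc
  have key := setLIntegral_sqrt_mul_le (x := 3 * d₁ * x.1) (y := 3 * d₂ * x.2)
    (by simp [hd₁, hx₁]) (by simp [hd₂, hx₂]) (K := fun v => K (v + c)) (by fun_prop) hZ
    (half_pos hA₁) (half_pos hA₂)
  rw [lintegral_add_right_eq_self] at key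
  have e : ∀ z : ℝ × ℝ, pairKernel d₁ d₂ K A x (z - (A.1 / 2, A.2 / 2)) =
      2 * S.indicator (fun z => ENNReal.ofReal (√(z.1 * z.2)) *
        K (3 * d₁ * x.1 * z.1 ^ 2 + 3 * d₂ * x.2 * z.2 ^ 2 + c)) z := by
    intro z
    have i1 : A.1 + 2 * (z.1 - A.1 / 2) = 2 * z.1 := by ring
    have i2 : A.2 + 2 * (z.2 - A.2 / 2) = 2 * z.2 := by ring
    have hiff : (z - (A.1 / 2, A.2 / 2)) ∈ {y : ℝ × ℝ | 0 < A.1 + 2 * y.1 ∧ 0 < A.2 + 2 * y.2 ∧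
        |y.1| * |y.2| ≤ |x.1 * x.2|} ↔ z ∈ S := by
      simp only [hS, Set.mem_ofPred_eq, Prod.fst_sub, Prod.snd_sub, i1, i2]
      simp
    by_cases hz : z ∈ S
    · rw [pairKernel, Set.indicator_of_mem (hiff.2 hz), Set.indicator_of_mem hz]
      simp only [Prod.fst_sub, Prod.snd_sub, i1, i2]
      rw [← mul_assoc (2 : ENNReal)]
      congr 1
      · rw [show 2 * z.1 * (2 * z.2) = 2 ^ 2 * (z.1 * z.2) by ring, Real.sqrt_mul (by norm_num),
          Real.sqrt_sq (by norm_num), ENNReal.ofReal_mul (by norm_num)]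
        simp
      · congr 1
        rw [hc]; ring
    · rw [pairKernel, Set.indicator_of_notMem (fun h => hz (hiff.1 h)), Set.indicator_of_notMem hz,
        mul_zero]
  rw [← lintegral_sub_right_eq_self _ (A.1 / 2, A.2 / 2)]
  simp only [e]
  rw [lintegral_const_mul' _ _ (by norm_num), lintegral_indicator mS]
  have : 36 * |x.1 * x.2| / |3 * d₁ * x.1 * (3 * d₂ * x.2)| = 4 / |d₁ * d₂| := by
    rw [show 3 * d₁ * x.1 * (3 * d₂ * x.2) = 9 * (d₁ * d₂) * (x.1 * x.2) by ring, abs_mul (9 * (d₁ * d₂)),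
      abs_mul 9, abs_of_pos (by norm_num : (0 : ℝ) < 9)]
    have : 0 < |d₁ * d₂| := abs_pos.2 (mul_ne_zero hd₁ hd₂)
    field_simp
    norm_num
  rw [this] at key
  calc _ ≤ 2 * (3 * (ENNReal.ofReal (√(4 / |d₁ * d₂|)) * ∫⁻ v, K v)) := by gcongr
    _ = _ := by ring

theorem weight_product_le {a₁ a₂ a₃ a₄ b₁ b₂ b₃ b₄ r₁ r₂ r₃ r₄ : ℝ} (ha₁ : 0 < a₁) (ha₂ : 0 < a₂)
    (ha₃ : 0 < a₃) (ha₄ : 0 < a₄) (hb₁ : 0 < b₁) (hb₂ : 0 < b₂) (hb₃ : 0 < b₃) (hb₄ : 0 < b₄) :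
    (|a₁ * b₁| ^ ((1 : ℝ) / 8) * r₁) * (|a₂ * b₂| ^ ((1 : ℝ) / 8) * r₂) *
        ((|a₃ * b₃| ^ ((1 : ℝ) / 8) * r₃) * (|a₄ * b₄| ^ ((1 : ℝ) / 8) * r₄)) ≤
      1 / 2 * (r₁ ^ 2 * r₃ ^ 2 * √((a₂ + a₄) * (b₂ + b₄)) +
        r₂ ^ 2 * r₄ ^ 2 * √((a₁ + a₃) * (b₁ + b₃))) := by
  set U := (a₂ + a₄) * (b₂ + b₄) with hU
  set V := (a₁ + a₃) * (b₁ + b₃) with hV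
  have hU0 : 0 < U := by positivity
  have hV0 : 0 < V := by positivity
  set W := |a₁ * b₁| ^ ((1 : ℝ) / 8) * |a₂ * b₂| ^ ((1 : ℝ) / 8) *
    (|a₃ * b₃| ^ ((1 : ℝ) / 8) * |a₄ * b₄| ^ ((1 : ℝ) / 8)) with hW
  have hW0 : 0 ≤ W := by positivity
  have h1 : (a₁ * b₁) * (a₃ * b₃) ≤ V ^ 2 := by
    have e1 : a₁ * b₁ ≤ V := by rw [hV]; gcongr <;> linarith
    have e2 : a₃ * b₃ ≤ V := by rw [hV]; gcongr <;> linarith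
    rw [sq]; gcongr
  have h2 : (a₂ * b₂) * (a₄ * b₄) ≤ U ^ 2 := by
    have e1 : a₂ * b₂ ≤ U := by rw [hU]; gcongr <;> linarith
    have e2 : a₄ * b₄ ≤ U := by rw [hU]; gcongr <;> linarith
    rw [sq]; gcongr
  have hWle : W ≤ √(√U) * √(√V) := by
    have e : W = ((a₁ * b₁) * (a₃ * b₃) * ((a₂ * b₂) * (a₄ * b₄))) ^ ((1 : ℝ) / 8) := by
      rw [hW, abs_of_pos (by positivity), abs_of_pos (by positivity), abs_of_pos (by positivity),
        abs_of_pos (by positivity),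
        Real.mul_rpow (x := a₁ * b₁ * (a₃ * b₃)) (y := a₂ * b₂ * (a₄ * b₄))
          (by positivity) (by positivity),
        Real.mul_rpow (x := a₁ * b₁) (y := a₃ * b₃) (by positivity) (by positivity),
        Real.mul_rpow (x := a₂ * b₂) (y := a₄ * b₄) (by positivity) (by positivity)]
      ring
    have e2 : √(√U) * √(√V) = (V ^ 2 * U ^ 2) ^ ((1 : ℝ) / 8) := by
      rw [Real.mul_rpow (by positivity) (by positivity), ← Real.rpow_natCast, ← Real.rpow_natCast,
        ← Real.rpow_mul hV0.le, ← Real.rpow_mul hU0.le, Real.sqrt_eq_rpow, Real.sqrt_eq_rpow,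
        Real.sqrt_eq_rpow, Real.sqrt_eq_rpow, ← Real.rpow_mul hV0.le, ← Real.rpow_mul hU0.le, mul_comm]
      norm_num
    rw [e, e2]
    gcongr
  set X := √(√U) with hX
  set Y := √(√V) with hY
  have hX2 : X ^ 2 = √U := Real.sq_sqrt (by positivity)
  have hY2 : Y ^ 2 = √V := Real.sq_sqrt (by positivity)
  rw [← hX2, ← hY2]
  have h5 : W * (r₁ * r₂ * r₃ * r₄) ≤ X * Y * |r₁ * r₂ * r₃ * r₄| :=
    (mul_le_mul_of_nonneg_left (le_abs_self _) hW0).trans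
      (mul_le_mul_of_nonneg_right hWle (abs_nonneg _))
  have h6 : X * Y * |r₁ * r₂ * r₃ * r₄| = (X * |r₁ * r₃|) * (Y * |r₂ * r₄|) := by
    rw [show r₁ * r₂ * r₃ * r₄ = (r₁ * r₃) * (r₂ * r₄) by ring, abs_mul]; ring
  have h7 : (X * |r₁ * r₃|) ^ 2 = r₁ ^ 2 * r₃ ^ 2 * X ^ 2 := by rw [mul_pow, sq_abs]; ring
  have h8 : (Y * |r₂ * r₄|) ^ 2 = r₂ ^ 2 * r₄ ^ 2 * Y ^ 2 := by rw [mul_pow, sq_abs]; ring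
  calc _ = W * (r₁ * r₂ * r₃ * r₄) := by rw [hW]; ring
    _ ≤ (X * |r₁ * r₃|) * (Y * |r₂ * r₄|) := h6 ▸ h5
    _ ≤ _ := by
      rw [← h7, ← h8]
      linarith [two_mul_le_add_sq (X * |r₁ * r₃|) (Y * |r₂ * r₄|)]

theorem lintegral_pair_exchange {T : ℝ × ℝ → ℝ × ℝ → ℝ × ℝ → ENNReal}
    (hT : Measurable fun z : (ℝ × ℝ) × (ℝ × ℝ) × (ℝ × ℝ) => T z.1 z.2.1 z.2.2) :
    ∫⁻ p, ∫⁻ x, ∫⁻ y, T (p + y) x (-y) = ∫⁻ p, ∫⁻ x, ∫⁻ y, T p x y := by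
  have m1 : Measurable fun z : ((ℝ × ℝ) × (ℝ × ℝ)) × (ℝ × ℝ) => T (z.1.1 + z.2) z.1.2 (-z.2) :=
    hT.comp (by fun_prop : Measurable fun z : ((ℝ × ℝ) × (ℝ × ℝ)) × (ℝ × ℝ) => (z.1.1 + z.2, z.1.2, -z.2))
  have m2 : Measurable fun z : ((ℝ × ℝ) × (ℝ × ℝ)) × (ℝ × ℝ) => T z.1.1 z.1.2 z.2 :=
    hT.comp (by fun_prop : Measurable fun z : ((ℝ × ℝ) × (ℝ × ℝ)) × (ℝ × ℝ) => (z.1.1, z.1.2, z.2))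
  rw [lintegral_lintegral_swap (f := fun p x => ∫⁻ y, T (p + y) x (-y))
      (show Measurable (Function.uncurry fun p x => ∫⁻ y, T (p + y) x (-y)) from
        m1.lintegral_prod_right').aemeasurable,
    lintegral_lintegral_swap (f := fun p x => ∫⁻ y, T p x y)
      (show Measurable (Function.uncurry fun p x => ∫⁻ y, T p x y) from
        m2.lintegral_prod_right').aemeasurable]
  refine lintegral_congr fun x => ?_
  calc ∫⁻ p, ∫⁻ y, T (p + y) x (-y) = ∫⁻ y, ∫⁻ p, T (p + y) x (-y) :=
        lintegral_lintegral_swap (hT.comp (by fun_prop : Measurable fun z : (ℝ × ℝ) × (ℝ × ℝ) =>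
          (z.1 + z.2, x, -z.2))).aemeasurable
    _ = ∫⁻ y, ∫⁻ p, T p x (-y) := by
        refine lintegral_congr fun y => ?_
        exact lintegral_add_right_eq_self (fun p => T p x (-y)) y
    _ = ∫⁻ p, ∫⁻ y, T p x (-y) := lintegral_lintegral_swap
          (hT.comp (by fun_prop : Measurable fun z : (ℝ × ℝ) × (ℝ × ℝ) =>
          (z.2, x, -z.1))).aemeasurable
    _ = _ := by
        refine lintegral_congr fun p => ?_
        exact lintegral_neg_eq_self (fun y => T p x y)

/-- The diagonal term `r(p)² r(p + x)²` weighted by the kernel of the pair `(p, p + x)`. -/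
def pairTerm (d₁ d₂ : ℝ) (K : ℝ → ENNReal) (r : ℝ × ℝ → ℝ) (p x y : ℝ × ℝ) : ENNReal :=
  ENNReal.ofReal (r p ^ 2 * r (p + x) ^ 2) * pairKernel d₁ d₂ K (p + (p + x)) x y

/-- The quadrilinear integrand at the vertices `p`, `p + x + y`, `p + x`, `p + y`. -/
def quadTerm (d₁ d₂ : ℝ) (K : ℝ → ENNReal) (κ : ℝ × ℝ → ℝ) (p₁ p₂ p₃ p₄ : ℝ × ℝ) : ENNReal :=
  ENNReal.ofReal (κ p₁ * κ p₂ * (κ p₃ * κ p₄)) *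
    K (cubicPhase d₁ d₂ p₁ + cubicPhase d₁ d₂ p₂ - (cubicPhase d₁ d₂ p₃ + cubicPhase d₁ d₂ p₄))

theorem measurable_cubicPhase (d₁ d₂ : ℝ) : Measurable (cubicPhase d₁ d₂) := by
  unfold cubicPhase; fun_prop

theorem measurable_pairTerm (d₁ d₂ : ℝ) {K : ℝ → ENNReal} (hK : Measurable K) {r : ℝ × ℝ → ℝ}
    (hr : Measurable r) :
    Measurable fun z : (ℝ × ℝ) × (ℝ × ℝ) × (ℝ × ℝ) => pairTerm d₁ d₂ K r z.1 z.2.1 z.2.2 := by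
  have h := (measurable_pairKernel d₁ d₂ hK).comp
    (by fun_prop : Measurable fun z : (ℝ × ℝ) × (ℝ × ℝ) × (ℝ × ℝ) =>
      (z.1 + (z.1 + z.2.1), z.2.1, z.2.2))
  have h2 : Measurable fun z : (ℝ × ℝ) × (ℝ × ℝ) × (ℝ × ℝ) =>
    ENNReal.ofReal (r z.1 ^ 2 * r (z.1 + z.2.1) ^ 2) := by fun_prop
  exact h2.mul h

theorem quadTerm_le_pairTerm {d₁ d₂ : ℝ} {K : ℝ → ENNReal} (hKe : ∀ v, K (-v) = K v)
    {r : ℝ × ℝ → ℝ} (hD : ∀ p, r p ≠ 0 → 0 < p.1 ∧ 0 < p.2) {p x y : ℝ × ℝ}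
    (hxy : |y.1| * |y.2| ≤ |x.1 * x.2|) :
    quadTerm d₁ d₂ K (fun p => |p.1 * p.2| ^ ((1 : ℝ) / 8) * r p) p (p + x + y) (p + x) (p + y) ≤
      2⁻¹ * (pairTerm d₁ d₂ K r p x y + pairTerm d₁ d₂ K r (p + y) x (-y)) := by
  by_cases h0 : r p = 0 ∨ r (p + x + y) = 0 ∨ r (p + x) = 0 ∨ r (p + y) = 0
  · have : quadTerm d₁ d₂ K (fun p => |p.1 * p.2| ^ ((1 : ℝ) / 8) * r p)
        p (p + x + y) (p + x) (p + y) = 0 := by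
      unfold quadTerm
      rcases h0 with h | h | h | h <;> simp [h]
    rw [this]; exact zero_le
  push Not at h0
  obtain ⟨h1, h2, h3, h4⟩ := h0
  obtain ⟨a1, b1⟩ := hD _ h1
  obtain ⟨a2, b2⟩ := hD _ h2
  obtain ⟨a3, b3⟩ := hD _ h3
  obtain ⟨a4, b4⟩ := hD _ h4
  have w := weight_product_le (r₁ := r p) (r₂ := r (p + x + y)) (r₃ := r (p + x))
    (r₄ := r (p + y)) a1 a2 a3 a4 b1 b2 b3 b4
  set Φ := cubicPhase d₁ d₂ p + cubicPhase d₁ d₂ (p + x + y) -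
    (cubicPhase d₁ d₂ (p + x) + cubicPhase d₁ d₂ (p + y)) with hΦ
  simp only [Prod.fst_add, Prod.snd_add] at a1 b1 a2 b2 a3 b3 a4 b4 w
  have e1 : pairTerm d₁ d₂ K r p x y = ENNReal.ofReal (r p ^ 2 * r (p + x) ^ 2 *
      √((p.1 + x.1 + y.1 + (p.1 + y.1)) * (p.2 + x.2 + y.2 + (p.2 + y.2)))) * K Φ := by
    unfold pairTerm pairKernel
    rw [Set.indicator_of_mem, ENNReal.ofReal_mul (p := r p ^ 2 * r (p + x) ^ 2) (by positivity), mul_assoc (ENNReal.ofReal _)]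
    · congr 1
      congr 1
      · congr 2
        simp only [Prod.fst_add, Prod.snd_add]; ring
      · congr 1
        simp only [hΦ, cubicPhase, Prod.fst_add, Prod.snd_add]; ring
    · refine ⟨?_, ?_, hxy⟩ <;> simp only [Prod.fst_add, Prod.snd_add] <;> linarith
  have e2 : pairTerm d₁ d₂ K r (p + y) x (-y) = ENNReal.ofReal (r (p + x + y) ^ 2 * r (p + y) ^ 2 *
      √((p.1 + (p.1 + x.1)) * (p.2 + (p.2 + x.2)))) * K Φ := by
    unfold pairTerm pairKernel
    rw [Set.indicator_of_mem,
      ENNReal.ofReal_mul (p := r (p + x + y) ^ 2 * r (p + y) ^ 2) (by positivity), mul_assoc (ENNReal.ofReal _)]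
    · congr 1
      on_goal 2 => congr 1
      · rw [add_right_comm p y x, mul_comm]
      · congr 2
        simp only [Prod.fst_add, Prod.snd_add, Prod.fst_neg, Prod.snd_neg]; ring
      · rw [← hKe]
        congr 1
        simp only [hΦ, cubicPhase, Prod.fst_add, Prod.snd_add, Prod.fst_neg, Prod.snd_neg]; ring
    · refine ⟨?_, ?_, by simpa using hxy⟩ <;>
        simp only [Prod.fst_add, Prod.snd_add, Prod.fst_neg, Prod.snd_neg] <;> linarith
  rw [e1, e2, ← add_mul, ← ENNReal.ofReal_add (by positivity) (by positivity), ← mul_assoc]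
  unfold quadTerm
  rw [← hΦ]
  gcongr
  rw [show (2 : ENNReal)⁻¹ = ENNReal.ofReal (1 / 2) by
    rw [one_div, ENNReal.ofReal_inv_of_pos (by norm_num)]; simp, ← ENNReal.ofReal_mul (by norm_num)]
  exact ENNReal.ofReal_le_ofReal (by simpa using w)

theorem lintegral_parallelogram {f : ℝ × ℝ → ℝ × ℝ → ℝ × ℝ → ENNReal}
    (hf : Measurable fun z : (ℝ × ℝ) × (ℝ × ℝ) × (ℝ × ℝ) => f z.1 z.2.1 z.2.2) :
    ∫⁻ ζ, ∫⁻ p, ∫⁻ q, f ζ p q = ∫⁻ p, ∫⁻ x, ∫⁻ y, f (p + (p + x) + y) p (p + x) := by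
  have m1 : Measurable fun z : ((ℝ × ℝ) × (ℝ × ℝ)) × (ℝ × ℝ) => f z.1.1 z.1.2 z.2 :=
    hf.comp (by fun_prop : Measurable fun z : ((ℝ × ℝ) × (ℝ × ℝ)) × (ℝ × ℝ) =>
      (z.1.1, z.1.2, z.2))
  rw [lintegral_lintegral_swap (show Measurable (Function.uncurry fun ζ p => ∫⁻ q, f ζ p q) from
        m1.lintegral_prod_right').aemeasurable]
  refine lintegral_congr fun p => ?_
  rw [lintegral_lintegral_swap (f := fun ζ q => f ζ p q)
    (hf.comp (by fun_prop : Measurable fun z : (ℝ × ℝ) × (ℝ × ℝ) => (z.1, p, z.2))).aemeasurable,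
    ← lintegral_add_left_eq_self _ p]
  refine lintegral_congr fun x => ?_
  exact (lintegral_add_left_eq_self (fun ζ => f ζ p (p + x)) (p + (p + x))).symm

theorem ae_fst_ne_zero_and_snd_ne_zero : ∀ᵐ x : ℝ × ℝ, x.1 ≠ 0 ∧ x.2 ≠ 0 := by
  have h : ∀ᵐ x : ℝ, x ≠ 0 := by simp [ae_iff]
  rw [Measure.volume_eq_prod]
  exact (Measure.quasiMeasurePreserving_fst.ae h).and (Measure.quasiMeasurePreserving_snd.ae h)

theorem lintegral_pairTerm_le {d₁ d₂ : ℝ} (hd₁ : d₁ ≠ 0) (hd₂ : d₂ ≠ 0) {K : ℝ → ENNReal}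
    (hK : Measurable K) {r : ℝ × ℝ → ℝ} (hr : Measurable r)
    (hD : ∀ p, r p ≠ 0 → 0 < p.1 ∧ 0 < p.2) :
    ∫⁻ p, ∫⁻ x, ∫⁻ y, pairTerm d₁ d₂ K r p x y ≤
      6 * ENNReal.ofReal (√(4 / |d₁ * d₂|)) * (∫⁻ v, K v) *
        (∫⁻ p, ENNReal.ofReal (r p ^ 2)) ^ 2 := by
  set B := 6 * ENNReal.ofReal (√(4 / |d₁ * d₂|)) * ∫⁻ v, K v with hB
  have mr : Measurable fun p => ENNReal.ofReal (r p ^ 2) := by fun_prop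
  calc _ ≤ ∫⁻ p, ∫⁻ x, ENNReal.ofReal (r p ^ 2) * ENNReal.ofReal (r (p + x) ^ 2) * B := by
        refine lintegral_mono fun p => lintegral_mono_ae ?_
        filter_upwards [ae_fst_ne_zero_and_snd_ne_zero] with x hx
        unfold pairTerm
        rw [lintegral_const_mul' _ _ ENNReal.ofReal_ne_top, ENNReal.ofReal_mul (by positivity)]
        by_cases h : r p = 0 ∨ r (p + x) = 0
        · rcases h with h | h <;> simp [h]
        push Not at h
        gcongr
        have h1 := hD _ h.1
        have h2 := hD _ h.2
        exact lintegral_pairKernel_le hd₁ hd₂ hK (add_pos h1.1 h2.1) (add_pos h1.2 h2.2) hx.1 hx.2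
    _ = _ := by
      have e : ∀ p, ∫⁻ x, ENNReal.ofReal (r p ^ 2) * ENNReal.ofReal (r (p + x) ^ 2) * B =
          ENNReal.ofReal (r p ^ 2) * ((∫⁻ x, ENNReal.ofReal (r x ^ 2)) * B) := by
        intro p
        simp only [mul_assoc]
        rw [lintegral_const_mul' _ _ ENNReal.ofReal_ne_top, lintegral_mul_const _ (by fun_prop),
          lintegral_add_left_eq_self (fun x => ENNReal.ofReal (r x ^ 2)) p]
      simp only [e]
      rw [lintegral_mul_const _ mr]
      ring

theorem lintegral_quadTerm_le {d₁ d₂ : ℝ} (hd₁ : d₁ ≠ 0) (hd₂ : d₂ ≠ 0) {K : ℝ → ENNReal}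
    (hK : Measurable K) (hKe : ∀ v, K (-v) = K v) {r : ℝ × ℝ → ℝ} (hr : Measurable r)
    (hD : ∀ p, r p ≠ 0 → 0 < p.1 ∧ 0 < p.2) :
    ∫⁻ ζ, ∫⁻ p, ∫⁻ q, quadTerm d₁ d₂ K (fun p => |p.1 * p.2| ^ ((1 : ℝ) / 8) * r p)
        p (ζ - p) q (ζ - q) ≤
      2 * (6 * ENNReal.ofReal (√(4 / |d₁ * d₂|)) * (∫⁻ v, K v) *
        (∫⁻ p, ENNReal.ofReal (r p ^ 2)) ^ 2) := by
  set κ : ℝ × ℝ → ℝ := fun p => |p.1 * p.2| ^ ((1 : ℝ) / 8) * r p with hκ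
  have mκ : Measurable κ := by fun_prop
  have mφ := measurable_cubicPhase d₁ d₂
  have mT := measurable_pairTerm d₁ d₂ hK hr
  have bT := lintegral_pairTerm_le hd₁ hd₂ hK hr hD
  have qT := fun p x y => quadTerm_le_pairTerm (d₁ := d₁) (d₂ := d₂) hKe hD (p := p) (x := x) (y := y)
  generalize pairTerm d₁ d₂ K r = T at mT bT qT
  obtain ⟨M, hM⟩ : ∃ M : ℝ × ℝ → ℝ × ℝ → ℝ × ℝ → ENNReal, ∀ p x y, M p x y =
    2⁻¹ * (T p x y + T (p + y) x (-y)) := ⟨_, fun _ _ _ => rfl⟩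
  have mT' : Measurable fun z : (ℝ × ℝ) × (ℝ × ℝ) × (ℝ × ℝ) =>
      T (z.1 + z.2.2) z.2.1 (-z.2.2) :=
    mT.comp (by fun_prop : Measurable fun z : (ℝ × ℝ) × (ℝ × ℝ) × (ℝ × ℝ) =>
      (z.1 + z.2.2, z.2.1, -z.2.2))
  have mM : Measurable fun z : (ℝ × ℝ) × (ℝ × ℝ) × (ℝ × ℝ) => M z.1 z.2.1 z.2.2 := by
    simp only [hM]
    exact (mT.add mT').const_mul _
  have mM3 : ∀ p x, Measurable fun y => M p x y := fun p x =>
    mM.comp (by fun_prop : Measurable fun y : ℝ × ℝ => (p, x, y))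
  have mM2 : ∀ p, Measurable fun x => ∫⁻ y, M p x y := fun p =>
    (mM.comp (by fun_prop : Measurable fun z : (ℝ × ℝ) × (ℝ × ℝ) =>
      (p, z.1, z.2))).lintegral_prod_right'
  have mM1 : Measurable fun p => ∫⁻ x, ∫⁻ y, M p x y :=
    ((mM.comp (by fun_prop : Measurable fun z : ((ℝ × ℝ) × (ℝ × ℝ)) × (ℝ × ℝ) =>
      (z.1.1, z.1.2, z.2))).lintegral_prod_right').lintegral_prod_right'
  have iM : ∫⁻ p, ∫⁻ x, ∫⁻ y, M p x y = ∫⁻ p, ∫⁻ x, ∫⁻ y, T p x y := by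
    have s3 : ∀ p x, Measurable fun y => T p x y := fun p x =>
      mT.comp (by fun_prop : Measurable fun y : ℝ × ℝ => (p, x, y))
    have s2 : ∀ p, Measurable fun x => ∫⁻ y, T p x y := fun p =>
      (mT.comp (by fun_prop : Measurable fun z : (ℝ × ℝ) × (ℝ × ℝ) =>
        (p, z.1, z.2))).lintegral_prod_right'
    have s1 : Measurable fun p => ∫⁻ x, ∫⁻ y, T p x y :=
      ((mT.comp (by fun_prop : Measurable fun z : ((ℝ × ℝ) × (ℝ × ℝ)) × (ℝ × ℝ) =>
        (z.1.1, z.1.2, z.2))).lintegral_prod_right').lintegral_prod_right'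
    simp only [hM]
    have c : (2⁻¹ : ENNReal) ≠ ⊤ := by simp
    simp only [lintegral_const_mul' _ _ c]
    simp only [lintegral_add_left (s3 _ _), lintegral_add_left (s2 _), lintegral_add_left s1]
    rw [lintegral_pair_exchange mT, ← two_mul, ← mul_assoc,
      ENNReal.inv_mul_cancel (by norm_num) (by norm_num), one_mul]
  rw [lintegral_parallelogram (f := fun ζ p q => quadTerm d₁ d₂ K κ p (ζ - p) q (ζ - q))
    (by unfold quadTerm; fun_prop)]
  have e1 : ∀ p x y : ℝ × ℝ, p + (p + x) + y - p = p + x + y := fun p x y => by abel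
  have e2 : ∀ p x y : ℝ × ℝ, p + (p + x) + y - (p + x) = p + y := fun p x y => by abel
  simp only [e1, e2]
  calc _ ≤ ∫⁻ p, ∫⁻ x, ∫⁻ y, (M p x y + M p y x) := by
        refine lintegral_mono fun p => lintegral_mono fun x => lintegral_mono fun y => ?_
        rcases le_total (|y.1| * |y.2|) (|x.1| * |x.2|) with h | h
        · rw [← abs_mul x.1] at h
          exact (qT p x y h).trans ((hM p x y).ge.trans le_self_add)
        · rw [← abs_mul y.1] at h
          have hs : quadTerm d₁ d₂ K κ p (p + x + y) (p + x) (p + y) =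
              quadTerm d₁ d₂ K κ p (p + y + x) (p + y) (p + x) := by
            unfold quadTerm
            rw [add_right_comm p x y, mul_comm (κ (p + x)),
              add_comm (cubicPhase d₁ d₂ (p + x))]
          exact hs.trans_le ((qT p y x h).trans ((hM p y x).ge.trans le_add_self))
    _ = (∫⁻ p, ∫⁻ x, ∫⁻ y, M p x y) + ∫⁻ p, ∫⁻ x, ∫⁻ y, M p y x := by
        simp only [lintegral_add_left (mM3 _ _), lintegral_add_left (mM2 _),
          lintegral_add_left mM1]
    _ = 2 * ∫⁻ p, ∫⁻ x, ∫⁻ y, M p x y := by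
        rw [two_mul]
        congr 1
        refine lintegral_congr fun p => ?_
        exact lintegral_lintegral_swap (f := fun x y => M p y x)
          (mM.comp (by fun_prop : Measurable fun z : (ℝ × ℝ) × (ℝ × ℝ) =>
            (p, z.2, z.1))).aemeasurable
    _ ≤ _ := by
        rw [iM]
        gcongr

/-- The `L²` norm of an oscillatory superposition is controlled by its correlation kernel. -/
theorem lintegral_enorm_integral_sq_le {T P : Type*} [MeasurableSpace T] [MeasurableSpace P]
    (ν : Measure T) [IsFiniteMeasure ν] (μ : Measure P) [SFinite μ] {e : T → P → ℂ}
    (he : Measurable (Function.uncurry e)) (hn : ∀ t p, ‖e t p‖ = 1) {k : P → ℂ}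
    (hk : Integrable k μ) :
    ∫⁻ t, ‖∫ p, e t p * k p ∂μ‖ₑ ^ 2 ∂ν ≤
      ∫⁻ p, ∫⁻ q, ‖k p‖ₑ * ‖k q‖ₑ * ‖∫ t, e t p * (starRingEnd ℂ) (e t q) ∂ν‖ₑ ∂μ ∂μ := by
  set f : T → ℂ := fun t => ∫ p, e t p * k p ∂μ with hf
  have het : ∀ t, Measurable (e t) := fun t => he.comp measurable_prodMk_left
  have hint : ∀ t, Integrable (fun p => e t p * k p) μ := fun t =>
    hk.bdd_mul (het t).aestronglyMeasurable (Filter.Eventually.of_forall fun p => (hn t p).le)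
  have hfm : AEStronglyMeasurable f ν := by
    have : AEStronglyMeasurable (fun z : T × P => e z.1 z.2 * k z.2) (ν.prod μ) :=
      he.aestronglyMeasurable.mul hk.aestronglyMeasurable.comp_snd
    exact this.integral_prod_right'
  have hfb : ∀ t, ‖f t‖ ≤ ∫ p, ‖k p‖ ∂μ := fun t =>
    (norm_integral_le_integral_norm _).trans_eq (integral_congr_ae
      (Filter.Eventually.of_forall fun p => by simp [hn]))
  have hfi : Integrable (fun t => ‖f t‖ ^ 2) ν := by
    refine Integrable.mono' (integrable_const ((∫ p, ‖k p‖ ∂μ) ^ 2)) (hfm.norm.pow 2)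
      (Filter.Eventually.of_forall fun t => ?_)
    rw [Real.norm_of_nonneg (by positivity)]
    gcongr
    exact hfb t
  have h1 : ∫⁻ t, ‖f t‖ₑ ^ 2 ∂ν = ‖∫ t, f t * (starRingEnd ℂ) (f t) ∂ν‖ₑ := by
    have : ∀ t, f t * (starRingEnd ℂ) (f t) = ((‖f t‖ ^ 2 : ℝ) : ℂ) := fun t => by
      rw [Complex.mul_conj']; push_cast; rfl
    simp only [this]
    rw [integral_complex_ofReal, ← ofReal_norm, Complex.norm_real, Real.norm_of_nonneg (integral_nonneg fun t => by positivity),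
      ofReal_integral_eq_lintegral_ofReal hfi (Filter.Eventually.of_forall fun t => by positivity)]
    refine lintegral_congr fun t => ?_
    rw [ENNReal.ofReal_pow (norm_nonneg _), ofReal_norm]
  have h2 : ∀ t, f t * (starRingEnd ℂ) (f t) =
      ∫ z, (e t z.1 * (starRingEnd ℂ) (e t z.2)) * (k z.1 * (starRingEnd ℂ) (k z.2)) ∂(μ.prod μ) := by
    intro t
    rw [hf, ← integral_conj, ← integral_prod_mul]
    congr 1
    ext z
    simp only [map_mul]
    ring
  have hkk : Integrable (fun z : P × P => k z.1 * (starRingEnd ℂ) (k z.2)) (μ.prod μ) :=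
    hk.mul_prod ((Complex.conjLIE.integrable_comp_iff).2 hk)
  have m1 : Measurable fun z : T × (P × P) => e z.1 z.2.1 * (starRingEnd ℂ) (e z.1 z.2.2) := by
    have a : Measurable fun z : T × (P × P) => e z.1 z.2.1 :=
      he.comp (by fun_prop : Measurable fun z : T × (P × P) => (z.1, z.2.1))
    have b : Measurable fun z : T × (P × P) => e z.1 z.2.2 :=
      he.comp (by fun_prop : Measurable fun z : T × (P × P) => (z.1, z.2.2))
    exact a.mul (Complex.continuous_conj.measurable.comp b)
  have hbig : Integrable (Function.uncurry fun t (z : P × P) =>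
      (e t z.1 * (starRingEnd ℂ) (e t z.2)) * (k z.1 * (starRingEnd ℂ) (k z.2)))
      (ν.prod (μ.prod μ)) :=
    (hkk.comp_snd ν).bdd_mul (c := 1) m1.aestronglyMeasurable
      (Filter.Eventually.of_forall fun z => by simp [hn])
  calc ∫⁻ t, ‖f t‖ₑ ^ 2 ∂ν = ‖∫ t, f t * (starRingEnd ℂ) (f t) ∂ν‖ₑ := h1
    _ = ‖∫ z, (∫ t, e t z.1 * (starRingEnd ℂ) (e t z.2) ∂ν) *
          (k z.1 * (starRingEnd ℂ) (k z.2)) ∂(μ.prod μ)‖ₑ := by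
        simp only [h2]
        rw [integral_integral_swap hbig]
        simp only [integral_mul_const]
    _ ≤ ∫⁻ z, ‖(∫ t, e t z.1 * (starRingEnd ℂ) (e t z.2) ∂ν) *
          (k z.1 * (starRingEnd ℂ) (k z.2))‖ₑ ∂(μ.prod μ) := enorm_integral_le_lintegral_enorm _
    _ = _ := by
        have hm : AEStronglyMeasurable (fun z : P × P => ∫ t, e t z.1 * (starRingEnd ℂ) (e t z.2) ∂ν)
            (μ.prod μ) := by
          have := (m1.comp measurable_swap).stronglyMeasurable.integral_prod_right' (ν := ν)
          exact this.aestronglyMeasurable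
        refine (lintegral_prod _ (hm.mul hkk.aestronglyMeasurable).enorm).trans ?_
        refine lintegral_congr fun p => lintegral_congr fun q => ?_
        simp only [Pi.mul_apply, enorm_mul, RCLike.enorm_conj]
        ring

/-- The Gaussian measure of density `exp (-η t²)`. -/
def gaussianMeasure (η : ℝ) : Measure ℝ :=
  volume.withDensity fun t => ENNReal.ofReal (Real.exp (-η * t ^ 2))

/-- The Fourier transform of `gaussianMeasure η`. -/
def gaussianKernel (η v : ℝ) : ℝ := √(Real.pi / η) * Real.exp (-(4 * η)⁻¹ * v ^ 2)

theorem isFiniteMeasure_gaussianMeasure {η : ℝ} (hη : 0 < η) :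
    IsFiniteMeasure (gaussianMeasure η) :=
  isFiniteMeasure_withDensity_ofReal (integrable_exp_neg_mul_sq hη).hasFiniteIntegral

theorem lintegral_gaussianMeasure (η : ℝ) {f : ℝ → ENNReal} (hf : Measurable f) :
    ∫⁻ t, f t ∂(gaussianMeasure η) = ∫⁻ t, ENNReal.ofReal (Real.exp (-η * t ^ 2)) * f t :=
  lintegral_withDensity_eq_lintegral_mul _ (by fun_prop) hf

theorem integral_gaussianMeasure {η : ℝ} (hη : 0 < η) (v : ℝ) :
    ∫ t : ℝ, Complex.exp (Complex.I * (t * v : ℝ)) ∂(gaussianMeasure η) = gaussianKernel η v := by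
  have h := fourierIntegral_gaussian (b := (η : ℂ)) (by simpa using hη) (v : ℂ)
  rw [gaussianMeasure, integral_withDensity_eq_integral_toReal_smul (by fun_prop) (by simp)]
  calc _ = ∫ x : ℝ, Complex.exp (Complex.I * v * x) * Complex.exp (-η * x ^ 2) := by
        congr 1
        ext t
        rw [ENNReal.toReal_ofReal (Real.exp_nonneg _), Complex.real_smul, mul_comm]
        push_cast
        ring_nf
    _ = _ := by
        rw [h, gaussianKernel, Real.sqrt_eq_rpow, Complex.ofReal_mul,
          Complex.ofReal_cpow (by positivity)]
        push_cast
        congr 2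
        have : (η : ℂ) ≠ 0 := by exact_mod_cast hη.ne'
        field_simp

theorem gaussianKernel_nonneg (η v : ℝ) : 0 ≤ gaussianKernel η v := by
  unfold gaussianKernel; positivity

theorem gaussianKernel_neg (η v : ℝ) : gaussianKernel η (-v) = gaussianKernel η v := by
  simp [gaussianKernel]

theorem measurable_gaussianKernel (η : ℝ) : Measurable (gaussianKernel η) := by
  unfold gaussianKernel; fun_prop

theorem lintegral_gaussianKernel {η : ℝ} (hη : 0 < η) {c : ℝ} (hc : c ≠ 0) :
    ∫⁻ v, ENNReal.ofReal (gaussianKernel η (c * v)) = ENNReal.ofReal (2 * Real.pi / |c|) := by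
  have e : ∀ v, gaussianKernel η (c * v) =
      √(Real.pi / η) * Real.exp (-((4 * η)⁻¹ * c ^ 2) * v ^ 2) := fun v => by
    unfold gaussianKernel; ring_nf
  have hb : 0 < (4 * η)⁻¹ * c ^ 2 := by positivity
  simp only [e]
  rw [← ofReal_integral_eq_lintegral_ofReal ((integrable_exp_neg_mul_sq hb).const_mul _)
    (Filter.Eventually.of_forall fun v => by positivity), integral_const_mul, integral_gaussian,
    ← Real.sqrt_mul (by positivity)]
  congr 1
  rw [show Real.pi / η * (Real.pi / ((4 * η)⁻¹ * c ^ 2)) = (2 * Real.pi / |c|) ^ 2 by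
    rw [div_pow, sq_abs]; field_simp; ring]
  exact Real.sqrt_sq (by positivity)

theorem lintegral_le_of_weight_tendsto {α : Type*} [MeasurableSpace α] {μ : Measure α}
    {f : α → ENNReal} (hf : Measurable f) {w : ℕ → α → ENNReal} (hw : ∀ n, Measurable (w n))
    (hw1 : ∀ a, Filter.Tendsto (fun n => w n a) Filter.atTop (nhds 1)) {C : ENNReal}
    (h : ∀ n, ∫⁻ a, w n a * f a ∂μ ≤ C) : ∫⁻ a, f a ∂μ ≤ C := by
  have hl : ∀ a, Filter.liminf (fun n => w n a * f a) Filter.atTop = f a := fun a => by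
    have := ENNReal.Tendsto.mul_const (b := f a) (hw1 a) (Or.inl one_ne_zero)
    rw [one_mul] at this
    exact this.liminf_eq
  calc ∫⁻ a, f a ∂μ = ∫⁻ a, Filter.liminf (fun n => w n a * f a) Filter.atTop ∂μ := by
        simp only [hl]
    _ ≤ Filter.liminf (fun n => ∫⁻ a, w n a * f a ∂μ) Filter.atTop :=
        lintegral_liminf_le fun n => (hw n).mul hf
    _ ≤ C := by
        refine Filter.liminf_le_of_frequently_le' ?_
        exact Filter.Frequently.of_forall h

theorem tendsto_gaussian_weight (t : ℝ) :
    Filter.Tendsto (fun n : ℕ => ENNReal.ofReal (Real.exp (-(1 / ((n : ℝ) + 1)) * t ^ 2)))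
      Filter.atTop (nhds 1) := by
  have h := tendsto_one_div_add_atTop_nhds_zero_nat (𝕜 := ℝ)
  have h2 : Filter.Tendsto (fun n : ℕ => Real.exp (-(1 / ((n : ℝ) + 1)) * t ^ 2))
      Filter.atTop (nhds (Real.exp (-0 * t ^ 2))) :=
    (Real.continuous_exp.tendsto _).comp ((h.neg).mul_const _)
  simpa using ENNReal.tendsto_ofReal h2

theorem lintegral_le_of_gaussianMeasure_le {f : ℝ → ENNReal} (hf : Measurable f) {C : ENNReal}
    (h : ∀ η, 0 < η → ∫⁻ t, f t ∂(gaussianMeasure η) ≤ C) : ∫⁻ t, f t ≤ C := by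
  refine lintegral_le_of_weight_tendsto hf
    (w := fun n t => ENNReal.ofReal (Real.exp (-(1 / ((n : ℝ) + 1)) * t ^ 2)))
    (fun n => by fun_prop) tendsto_gaussian_weight fun n => ?_
  rw [← lintegral_gaussianMeasure _ hf]
  exact h _ (by positivity)

theorem lintegral_le_of_gaussianMeasure_prod_le {f : ℝ × ℝ → ENNReal} (hf : Measurable f)
    {C : ENNReal}
    (h : ∀ η, 0 < η → ∫⁻ z, f z ∂((gaussianMeasure η).prod (gaussianMeasure η)) ≤ C) :
    ∫⁻ z, f z ≤ C := by
  refine lintegral_le_of_weight_tendsto hf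
    (w := fun n z => ENNReal.ofReal (Real.exp (-(1 / ((n : ℝ) + 1)) * z.1 ^ 2)) *
      ENNReal.ofReal (Real.exp (-(1 / ((n : ℝ) + 1)) * z.2 ^ 2)))
    (fun n => by fun_prop) (fun z => ?_) fun n => ?_
  · simpa using ENNReal.Tendsto.mul (tendsto_gaussian_weight z.1) (Or.inl one_ne_zero)
      (tendsto_gaussian_weight z.2) (Or.inl one_ne_zero)
  · refine le_trans (le_of_eq ?_) (h (1 / ((n : ℝ) + 1)) (by positivity))
    rw [gaussianMeasure, prod_withDensity (by fun_prop) (by fun_prop),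
      lintegral_withDensity_eq_lintegral_mul _ (by fun_prop) hf]
    rfl

theorem integral_gaussianMeasure_prod {η : ℝ} (hη : 0 < η) (v : ℝ × ℝ) :
    ∫ z : ℝ × ℝ, Complex.exp (Complex.I * (z.1 * v.1 + z.2 * v.2 : ℝ))
      ∂((gaussianMeasure η).prod (gaussianMeasure η)) =
      ((gaussianKernel η v.1 * gaussianKernel η v.2 : ℝ) : ℂ) := by
  have := isFiniteMeasure_gaussianMeasure hη
  rw [Complex.ofReal_mul, ← integral_gaussianMeasure hη, ← integral_gaussianMeasure hη,
    ← integral_prod_mul]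
  congr 1
  ext z
  rw [← Complex.exp_add]
  push_cast
  ring_nf

theorem exp_mul_conj_exp (a b : ℝ) :
    Complex.exp (Complex.I * a) * (starRingEnd ℂ) (Complex.exp (Complex.I * b)) =
      Complex.exp (Complex.I * (a - b : ℝ)) := by
  rw [← Complex.exp_conj, ← Complex.exp_add]
  simp only [map_mul, Complex.conj_I, Complex.conj_ofReal]
  push_cast
  ring_nf

theorem enorm_mul_enorm_le (a b : ℂ) : ‖a‖ₑ * ‖b‖ₑ ≤ 2⁻¹ * (‖a‖ₑ ^ 2 + ‖b‖ₑ ^ 2) := by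
  simp only [← ofReal_norm]
  rw [← ENNReal.ofReal_mul (norm_nonneg _), ← ENNReal.ofReal_pow (norm_nonneg _),
    ← ENNReal.ofReal_pow (norm_nonneg _), ← ENNReal.ofReal_add (by positivity) (by positivity),
    show (2 : ENNReal)⁻¹ = ENNReal.ofReal (2⁻¹) by
      rw [ENNReal.ofReal_inv_of_pos (by norm_num)]; simp,
    ← ENNReal.ofReal_mul (by norm_num)]
  exact ENNReal.ofReal_le_ofReal (by linarith [two_mul_le_add_sq ‖a‖ ‖b‖])

/-- The upper half of Plancherel's theorem for integrable functions on the plane. -/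
theorem lintegral_enorm_fourier_sq_le {c₁ c₂ : ℝ} (hc₁ : c₁ ≠ 0) (hc₂ : c₂ ≠ 0) {h : ℝ × ℝ → ℂ}
    (hh : Integrable h) :
    ∫⁻ x : ℝ × ℝ, ‖∫ p : ℝ × ℝ,
        Complex.exp (Complex.I * (x.1 * (c₁ * p.1) + x.2 * (c₂ * p.2) : ℝ)) * h p‖ₑ ^ 2 ≤
      ENNReal.ofReal (2 * Real.pi / |c₁|) * ENNReal.ofReal (2 * Real.pi / |c₂|) *
        ∫⁻ p, ‖h p‖ₑ ^ 2 := by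
  have me : Measurable (Function.uncurry fun x p : ℝ × ℝ =>
      Complex.exp (Complex.I * (x.1 * (c₁ * p.1) + x.2 * (c₂ * p.2) : ℝ))) := by
    unfold Function.uncurry; fun_prop
  wlog hm : Measurable h generalizing h
  · obtain ⟨g, hg, hgh⟩ := hh.aestronglyMeasurable.aemeasurable
    have := this (hh.congr hgh) hg
    have e1 : ∀ x : ℝ × ℝ, ∫ p : ℝ × ℝ,
        Complex.exp (Complex.I * (x.1 * (c₁ * p.1) + x.2 * (c₂ * p.2) : ℝ)) * h p = ∫ p : ℝ × ℝ,
        Complex.exp (Complex.I * (x.1 * (c₁ * p.1) + x.2 * (c₂ * p.2) : ℝ)) * g p := fun x =>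
      integral_congr_ae (hgh.mono fun p hp => by simp only [hp])
    have e2 : ∫⁻ p, ‖h p‖ₑ ^ 2 = ∫⁻ p, ‖g p‖ₑ ^ 2 :=
      lintegral_congr_ae (hgh.mono fun p hp => by simp only [hp])
    simpa only [e1, e2] using this
  refine lintegral_le_of_gaussianMeasure_prod_le ?_ fun η hη => ?_
  · have : StronglyMeasurable fun x : ℝ × ℝ => ∫ p : ℝ × ℝ,
        Complex.exp (Complex.I * (x.1 * (c₁ * p.1) + x.2 * (c₂ * p.2) : ℝ)) * h p :=
      (me.mul (hm.comp measurable_snd)).stronglyMeasurable.integral_prod_right'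
    exact this.measurable.enorm.pow_const 2
  have := isFiniteMeasure_gaussianMeasure hη
  have hK := measurable_gaussianKernel η
  set J : ℝ × ℝ → ENNReal := fun v => ENNReal.ofReal (gaussianKernel η (c₁ * v.1)) *
    ENNReal.ofReal (gaussianKernel η (c₂ * v.2)) with hJ
  have mJ : Measurable J := by fun_prop
  have iJ : ∫⁻ v, J v = ENNReal.ofReal (2 * Real.pi / |c₁|) * ENNReal.ofReal (2 * Real.pi / |c₂|) := by
    rw [Measure.volume_eq_prod, lintegral_prod_mul
      (f := fun v => ENNReal.ofReal (gaussianKernel η (c₁ * v)))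
      (g := fun v => ENNReal.ofReal (gaussianKernel η (c₂ * v))) (by fun_prop) (by fun_prop),
      lintegral_gaussianKernel hη hc₁, lintegral_gaussianKernel hη hc₂]
  refine (lintegral_enorm_integral_sq_le _ volume me (fun x p => by
    rw [mul_comm]; exact Complex.norm_exp_ofReal_mul_I _) hh).trans ?_
  have hcorr : ∀ p q : ℝ × ℝ, ‖∫ x : ℝ × ℝ,
      Complex.exp (Complex.I * (x.1 * (c₁ * p.1) + x.2 * (c₂ * p.2) : ℝ)) * (starRingEnd ℂ)
        (Complex.exp (Complex.I * (x.1 * (c₁ * q.1) + x.2 * (c₂ * q.2) : ℝ)))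
      ∂((gaussianMeasure η).prod (gaussianMeasure η))‖ₑ = J (p - q) := by
    intro p q
    have := integral_gaussianMeasure_prod hη (c₁ * (p.1 - q.1), c₂ * (p.2 - q.2))
    simp only [exp_mul_conj_exp]
    simp only [hJ, ← ENNReal.ofReal_mul (gaussianKernel_nonneg _ _), Prod.fst_sub, Prod.snd_sub]
    rw [← abs_of_nonneg (mul_nonneg (gaussianKernel_nonneg η (c₁ * (p.1 - q.1)))
      (gaussianKernel_nonneg η (c₂ * (p.2 - q.2)))), ← Real.norm_eq_abs,
      ← Complex.norm_real, ← this, ofReal_norm]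
    congr 2
    ext x
    congr 3
    ring
  simp only [hcorr]
  have m2 : Measurable fun p => ‖h p‖ₑ ^ 2 := hm.enorm.pow_const 2
  calc _ ≤ ∫⁻ p, ∫⁻ q, (2⁻¹ * (‖h p‖ₑ ^ 2 * J (p - q)) + 2⁻¹ * (‖h q‖ₑ ^ 2 * J (p - q))) := by
        refine lintegral_mono fun p => lintegral_mono fun q => ?_
        rw [← mul_add, ← add_mul, ← mul_assoc (2⁻¹ : ENNReal)]
        exact mul_le_mul_left (enorm_mul_enorm_le _ _) _
    _ = 2⁻¹ * (∫⁻ p, ∫⁻ q, ‖h p‖ₑ ^ 2 * J (p - q)) +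
          2⁻¹ * ∫⁻ p, ∫⁻ q, ‖h q‖ₑ ^ 2 * J (p - q) := by
        have c : (2⁻¹ : ENNReal) ≠ ⊤ := by simp
        have a : Measurable fun z : (ℝ × ℝ) × (ℝ × ℝ) => ‖h z.1‖ₑ ^ 2 * J (z.1 - z.2) := by fun_prop
        have a1 : Measurable fun p => ∫⁻ q, ‖h p‖ₑ ^ 2 * J (p - q) := a.lintegral_prod_right'
        have a2 : ∀ p, Measurable fun q => 2⁻¹ * (‖h p‖ₑ ^ 2 * J (p - q)) := fun p => by fun_prop
        simp only [lintegral_add_left (a2 _), lintegral_const_mul' _ _ c]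
        rw [lintegral_add_left (a1.const_mul _), lintegral_const_mul' _ _ c,
          lintegral_const_mul' _ _ c]
    _ = 2⁻¹ * ((∫⁻ v, J v) * ∫⁻ p, ‖h p‖ₑ ^ 2) + 2⁻¹ * ((∫⁻ v, J v) * ∫⁻ p, ‖h p‖ₑ ^ 2) := by
        congr 2
        · have : ∀ p : ℝ × ℝ, ∫⁻ q, ‖h p‖ₑ ^ 2 * J (p - q) = ‖h p‖ₑ ^ 2 * ∫⁻ v, J v := fun p => by
            rw [lintegral_const_mul _ (by fun_prop), lintegral_sub_left_eq_self J p]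
          simp only [this]
          rw [lintegral_mul_const _ m2, mul_comm]
        · rw [lintegral_lintegral_swap (by unfold Function.uncurry; fun_prop)]
          have : ∀ q : ℝ × ℝ, ∫⁻ p, ‖h q‖ₑ ^ 2 * J (p - q) = ‖h q‖ₑ ^ 2 * ∫⁻ v, J v := fun q => by
            rw [lintegral_const_mul _ (by fun_prop), lintegral_sub_right_eq_self J q]
          simp only [this]
          rw [lintegral_mul_const _ m2, mul_comm]
    _ = _ := by
        rw [← two_mul, ← mul_assoc, ENNReal.mul_inv_cancel (by norm_num) (by norm_num), one_mul, iJ]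

theorem sq_integral_eq_integral_convolution {m : ℝ × ℝ → ℂ} (hm : Integrable m) :
    (∫ p, m p) ^ 2 = ∫ ζ, ∫ p, m p * m (ζ - p) := by
  have h := integral_convolution (ContinuousLinearMap.mul ℂ ℂ) (μ := (volume : Measure (ℝ × ℝ)))
    (ν := (volume : Measure (ℝ × ℝ))) hm hm
  rw [sq]
  exact h.symm

/-- The product of the two phases carried by the pairs `(p, ζ - p)` of frequencies of sum `ζ`. -/
def pairExtension (d₁ d₂ : ℝ) (k : ℝ × ℝ → ℂ) (t : ℝ) (ζ : ℝ × ℝ) : ℂ :=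
  ∫ p, Complex.exp (Complex.I * (t * (cubicPhase d₁ d₂ p + cubicPhase d₁ d₂ (ζ - p)) : ℝ)) *
    (k p * k (ζ - p))

theorem stronglyMeasurable_pairExtension (d₁ d₂ : ℝ) {k : ℝ × ℝ → ℂ} (hk : Measurable k) :
    StronglyMeasurable (Function.uncurry (pairExtension d₁ d₂ k)) := by
  have hφ := measurable_cubicPhase d₁ d₂
  have : Measurable fun z : (ℝ × (ℝ × ℝ)) × (ℝ × ℝ) =>
      Complex.exp (Complex.I * (z.1.1 * (cubicPhase d₁ d₂ z.2 + cubicPhase d₁ d₂ (z.1.2 - z.2)) : ℝ)) *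
        (k z.2 * k (z.1.2 - z.2)) := by fun_prop
  exact this.stronglyMeasurable.integral_prod_right'

theorem integrable_exp_mul {P : Type*} [MeasurableSpace P] {μ : Measure P} {φ : P → ℝ}
    (hφ : Measurable φ) {k : P → ℂ} (hk : Integrable k μ) :
    Integrable (fun p => Complex.exp (Complex.I * φ p) * k p) μ :=
  hk.bdd_mul (c := 1) (by fun_prop : Measurable fun p => Complex.exp (Complex.I * φ p)).aestronglyMeasurable
    (Filter.Eventually.of_forall fun p => by rw [mul_comm, Complex.norm_exp_ofReal_mul_I])

theorem pairExtension_eq (d₁ d₂ : ℝ) (k : ℝ × ℝ → ℂ) (t : ℝ) (ζ : ℝ × ℝ) :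
    pairExtension d₁ d₂ k t ζ =
      ∫ p, (Complex.exp (Complex.I * (t * cubicPhase d₁ d₂ p : ℝ)) * k p) *
        (Complex.exp (Complex.I * (t * cubicPhase d₁ d₂ (ζ - p) : ℝ)) * k (ζ - p)) := by
  refine integral_congr_ae (Filter.Eventually.of_forall fun p => ?_)
  simp only
  rw [mul_mul_mul_comm, ← Complex.exp_add, ← mul_add, ← Complex.ofReal_add, ← mul_add]

theorem integrable_pairExtension (d₁ d₂ : ℝ) {k : ℝ × ℝ → ℂ} (hk : Integrable k) (t : ℝ) :
    Integrable (pairExtension d₁ d₂ k t) := by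
  have hφ := measurable_cubicPhase d₁ d₂
  have hm : Integrable fun p => Complex.exp (Complex.I * (t * cubicPhase d₁ d₂ p : ℝ)) * k p :=
    integrable_exp_mul (hφ.const_mul t) hk
  refine (hm.integrable_convolution (ContinuousLinearMap.mul ℂ ℂ) hm).congr
    (Filter.Eventually.of_forall fun ζ => ?_)
  exact (pairExtension_eq d₁ d₂ k t ζ).symm

theorem sq_extension_eq (c₁ c₂ d₁ d₂ : ℝ) {k : ℝ × ℝ → ℂ} (hk : Integrable k) (t : ℝ) (x : ℝ × ℝ) :
    (∫ p : ℝ × ℝ, Complex.exp (Complex.I * (x.1 * (c₁ * p.1) + x.2 * (c₂ * p.2) +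
        t * cubicPhase d₁ d₂ p : ℝ)) * k p) ^ 2 =
      ∫ ζ : ℝ × ℝ, Complex.exp (Complex.I * (x.1 * (c₁ * ζ.1) + x.2 * (c₂ * ζ.2) : ℝ)) *
        pairExtension d₁ d₂ k t ζ := by
  have hφ := measurable_cubicPhase d₁ d₂
  rw [sq_integral_eq_integral_convolution (integrable_exp_mul (by fun_prop) hk)]
  refine integral_congr_ae (Filter.Eventually.of_forall fun ζ => ?_)
  simp only [pairExtension]
  rw [← integral_const_mul]
  refine integral_congr_ae (Filter.Eventually.of_forall fun p => ?_)
  simp only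
  rw [mul_mul_mul_comm, ← Complex.exp_add, ← mul_assoc (Complex.exp _) (Complex.exp _),
    ← Complex.exp_add, ← mul_add, ← mul_add,
    ← Complex.ofReal_add, ← Complex.ofReal_add]
  congr 4
  simp only [Prod.fst_sub, Prod.snd_sub]
  ring

theorem lintegral_pairExtension_sq_le {d₁ d₂ : ℝ} (hd₁ : d₁ ≠ 0) (hd₂ : d₂ ≠ 0) {G : ℝ × ℝ → ℂ}
    (hG : Measurable G) (hD : ∀ p, G p ≠ 0 → 0 < p.1 ∧ 0 < p.2)
    (hk : Integrable fun p : ℝ × ℝ => ((|p.1 * p.2| ^ ((1 : ℝ) / 8) : ℝ) : ℂ) * G p) :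
    ∫⁻ t, ∫⁻ ζ, ‖pairExtension d₁ d₂
        (fun p : ℝ × ℝ => ((|p.1 * p.2| ^ ((1 : ℝ) / 8) : ℝ) : ℂ) * G p) t ζ‖ₑ ^ 2 ≤
      2 * (6 * ENNReal.ofReal (√(4 / |d₁ * d₂|)) * ENNReal.ofReal (2 * Real.pi) *
        (∫⁻ p, ‖G p‖ₑ ^ 2) ^ 2) := by
  set k : ℝ × ℝ → ℂ := fun p => ((|p.1 * p.2| ^ ((1 : ℝ) / 8) : ℝ) : ℂ) * G p with hkdef
  have mk : Measurable k := by fun_prop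
  have hφ := measurable_cubicPhase d₁ d₂
  have mH : Measurable (Function.uncurry fun t ζ => ‖pairExtension d₁ d₂ k t ζ‖ₑ ^ 2) :=
    (stronglyMeasurable_pairExtension d₁ d₂ mk).measurable.enorm.pow_const 2
  refine lintegral_le_of_gaussianMeasure_le mH.lintegral_prod_right' fun η hη => ?_
  have := isFiniteMeasure_gaussianMeasure hη
  have mK := measurable_gaussianKernel η
  have hq := lintegral_quadTerm_le hd₁ hd₂ (K := fun v => ENNReal.ofReal (gaussianKernel η v))
    (by fun_prop) (fun v => by rw [gaussianKernel_neg]) (r := fun p => ‖G p‖) hG.norm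
    (fun p hp => hD p (norm_ne_zero_iff.1 hp))
  have iK := lintegral_gaussianKernel hη one_ne_zero
  simp only [one_mul, abs_one, div_one] at iK
  have e1 : ∀ p, ENNReal.ofReal (‖G p‖ ^ 2) = ‖G p‖ₑ ^ 2 := fun p => by
    rw [ENNReal.ofReal_pow (norm_nonneg _), ofReal_norm]
  simp only [iK, e1] at hq
  refine le_trans ?_ hq
  refine (lintegral_lintegral_swap mH.aemeasurable).trans_le ?_
  refine lintegral_mono_ae ?_
  filter_upwards [hk.ae_convolution_exists (ContinuousLinearMap.mul ℂ ℂ) hk] with ζ hζ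
  have hζ' : Integrable fun p => k p * k (ζ - p) := hζ
  refine (lintegral_enorm_integral_sq_le (gaussianMeasure η) volume
    (e := fun t p => Complex.exp (Complex.I *
      (t * (cubicPhase d₁ d₂ p + cubicPhase d₁ d₂ (ζ - p)) : ℝ)))
    (by unfold Function.uncurry; fun_prop)
    (fun t p => by rw [mul_comm]; exact Complex.norm_exp_ofReal_mul_I _) hζ').trans (le_of_eq ?_)
  refine lintegral_congr fun p => lintegral_congr fun q => ?_
  simp only [exp_mul_conj_exp, ← mul_sub]
  rw [integral_gaussianMeasure hη, ← ofReal_norm (gaussianKernel η _ : ℂ), Complex.norm_real,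
    Real.norm_of_nonneg (gaussianKernel_nonneg _ _), quadTerm]
  congr 1
  rw [← ofReal_norm, ← ofReal_norm, ← ENNReal.ofReal_mul (norm_nonneg _)]
  have n : ∀ p, ‖k p‖ = |p.1 * p.2| ^ ((1 : ℝ) / 8) * ‖G p‖ := fun p => by
    rw [hkdef, norm_mul, Complex.norm_real, Real.norm_of_nonneg (by positivity)]
  simp only [norm_mul, n]

/-- The fourth-power extension estimate for frequencies in the open quadrant. -/
theorem lintegral_extension_pow_four_le {c₁ c₂ d₁ d₂ : ℝ} (hc₁ : c₁ ≠ 0) (hc₂ : c₂ ≠ 0)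
    (hd₁ : d₁ ≠ 0) (hd₂ : d₂ ≠ 0) {G : ℝ × ℝ → ℂ}
    (hG : Measurable G) (hD : ∀ p, G p ≠ 0 → 0 < p.1 ∧ 0 < p.2)
    (hk : Integrable fun p : ℝ × ℝ => ((|p.1 * p.2| ^ ((1 : ℝ) / 8) : ℝ) : ℂ) * G p) :
    ∫⁻ z : ℝ × ℝ × ℝ, ‖∫ p : ℝ × ℝ, Complex.exp (Complex.I * (z.2.1 * (c₁ * p.1) +
        z.2.2 * (c₂ * p.2) + z.1 * cubicPhase d₁ d₂ p : ℝ)) *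
          (((|p.1 * p.2| ^ ((1 : ℝ) / 8) : ℝ) : ℂ) * G p)‖ₑ ^ 4 ≤
      ENNReal.ofReal (2 * Real.pi / |c₁|) * ENNReal.ofReal (2 * Real.pi / |c₂|) *
        (2 * (6 * ENNReal.ofReal (√(4 / |d₁ * d₂|)) * ENNReal.ofReal (2 * Real.pi) *
        (∫⁻ p, ‖G p‖ₑ ^ 2) ^ 2)) := by
  have hH := lintegral_pairExtension_sq_le hd₁ hd₂ hG hD hk
  set k : ℝ × ℝ → ℂ := fun p => ((|p.1 * p.2| ^ ((1 : ℝ) / 8) : ℝ) : ℂ) * G p with hkdef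
  have mk : Measurable k := by fun_prop
  have hφ := measurable_cubicPhase d₁ d₂
  have mF : StronglyMeasurable fun z : ℝ × ℝ × ℝ => ∫ p : ℝ × ℝ, Complex.exp (Complex.I *
      (z.2.1 * (c₁ * p.1) + z.2.2 * (c₂ * p.2) + z.1 * cubicPhase d₁ d₂ p : ℝ)) * k p := by
    have : Measurable fun z : (ℝ × ℝ × ℝ) × (ℝ × ℝ) => Complex.exp (Complex.I *
      (z.1.2.1 * (c₁ * z.2.1) + z.1.2.2 * (c₂ * z.2.2) + z.1.1 * cubicPhase d₁ d₂ z.2 : ℝ)) *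
        k z.2 := by fun_prop
    exact this.stronglyMeasurable.integral_prod_right'
  rw [Measure.volume_eq_prod]
  refine (lintegral_prod _ (mF.measurable.enorm.pow_const 4).aemeasurable).trans_le ?_
  calc _ ≤ ∫⁻ t, ENNReal.ofReal (2 * Real.pi / |c₁|) * ENNReal.ofReal (2 * Real.pi / |c₂|) *
        ∫⁻ ζ, ‖pairExtension d₁ d₂ k t ζ‖ₑ ^ 2 := by
        refine lintegral_mono fun t => ?_
        refine le_trans (le_of_eq ?_)
          (lintegral_enorm_fourier_sq_le hc₁ hc₂ (integrable_pairExtension d₁ d₂ hk t))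
        refine lintegral_congr fun x => ?_
        rw [← sq_extension_eq c₁ c₂ d₁ d₂ hk t x, enorm_pow, ← pow_mul]
    _ ≤ _ := by
        rw [lintegral_const_mul' _ _ (by finiteness)]
        gcongr

theorem exists_linear_changeOfVariables {E : Type*} [NormedAddCommGroup E] [NormedSpace ℝ E]
    [FiniteDimensional ℝ E] [MeasureSpace E] [BorelSpace E] [(volume : Measure E).IsAddHaarMeasure]
    (L : E →ₗ[ℝ] E) (hL : Function.Injective L) :
    ∃ c : ℝ, 0 < c ∧ (∀ f : E → ENNReal, ∫⁻ q, f (L q) = ENNReal.ofReal c * ∫⁻ p, f p) ∧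
      (∀ f : E → ℂ, ∫ q, f (L q) = c • ∫ p, f p) ∧
      ∀ f : E → ℂ, Integrable f → Integrable fun q => f (L q) := by
  have hker : LinearMap.ker L = ⊥ := LinearMap.ker_eq_bot.2 hL
  have hdet : LinearMap.det L ≠ 0 := fun h =>
    (LinearMap.bot_lt_ker_of_det_eq_zero h).ne hker.symm
  have he : MeasurableEmbedding L :=
    (LinearMap.isClosedEmbedding_of_injective hker).measurableEmbedding
  have hm := Measure.map_linearMap_addHaar_eq_smul_addHaar (volume : Measure E) hdet
  refine ⟨|(LinearMap.det L)⁻¹|, by positivity, fun f => ?_, fun f => ?_, fun f hf => ?_⟩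
  · rw [← he.lintegral_map, hm, lintegral_smul_measure, smul_eq_mul]
  · rw [← he.integral_map, hm, integral_smul_measure, ENNReal.toReal_ofReal (abs_nonneg _)]
  · have := hf.smul_measure (c := ENNReal.ofReal |(LinearMap.det L)⁻¹|) ENNReal.ofReal_ne_top
    rw [← hm] at this
    exact he.integrable_map_iff.1 this

/-- The phase of the linear Zakharov–Kuznetsov evolution. -/
def zkPhase (z : ℝ × ℝ × ℝ) (p : ℝ × ℝ) : ℝ :=
  z.2.1 * p.1 + z.2.2 * p.2 + z.1 * (p.1 * (p.1 ^ 2 + p.2 ^ 2))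

theorem measurable_zkPhase : Measurable (Function.uncurry zkPhase) := by
  unfold zkPhase Function.uncurry; fun_prop

/-- The weight `|3ξ² - μ²|^{1/8}` applied to `w`. -/
def zkWeighted (w : ℝ × ℝ → ℂ) (p : ℝ × ℝ) : ℂ :=
  ((|3 * p.1 ^ 2 - p.2 ^ 2| ^ ((1 : ℝ) / 8) : ℝ) : ℂ) * w p

/-- The sectors cut out by the lines `3ξ² = μ²`. -/
def zkSector (σ τ : ℝ) : Set (ℝ × ℝ) :=
  {p | 0 < σ * (√3 * p.1 + p.2) ∧ 0 < τ * (√3 * p.1 - p.2)}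

theorem measurableSet_zkSector (σ τ : ℝ) : MeasurableSet (zkSector σ τ) := by
  have h₁ : Measurable fun p : ℝ × ℝ => σ * (√3 * p.1 + p.2) := by fun_prop
  have h₂ : Measurable fun p : ℝ × ℝ => τ * (√3 * p.1 - p.2) := by fun_prop
  exact (measurableSet_lt measurable_const h₁).inter (measurableSet_lt measurable_const h₂)

theorem measurable_zkWeighted {w : ℝ × ℝ → ℂ} (hw : Measurable w) : Measurable (zkWeighted w) := by
  unfold zkWeighted; fun_prop

/-- The linear coordinates diagonalising the cubic symbol. -/
def zkCoord (σ τ : ℝ) : ℝ × ℝ →ₗ[ℝ] ℝ × ℝ where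
  toFun q := (σ * q.1 + τ * q.2, √3 * (σ * q.1 - τ * q.2))
  map_add' x y := by ext <;> simp <;> ring
  map_smul' c x := by ext <;> simp <;> ring

theorem zkCoord_apply (σ τ : ℝ) (q : ℝ × ℝ) :
    zkCoord σ τ q = (σ * q.1 + τ * q.2, √3 * (σ * q.1 - τ * q.2)) := rfl

/-- The change of physical variables dual to `zkCoord`. -/
def zkDual : ℝ × ℝ × ℝ →ₗ[ℝ] ℝ × ℝ × ℝ where
  toFun z := (z.1, z.2.1 + √3 * z.2.2, z.2.1 - √3 * z.2.2)
  map_add' x y := by ext <;> simp <;> ring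
  map_smul' c x := by ext <;> simp <;> ring

theorem zkDual_apply (z : ℝ × ℝ × ℝ) :
    zkDual z = (z.1, z.2.1 + √3 * z.2.2, z.2.1 - √3 * z.2.2) := rfl

theorem zkCoord_injective {σ τ : ℝ} (hσ : σ ^ 2 = 1) (hτ : τ ^ 2 = 1) :
    Function.Injective (zkCoord σ τ) := by
  have h3 : √3 ≠ 0 := by positivity
  have hσ' : σ ≠ 0 := by rintro rfl; norm_num at hσ
  have hτ' : τ ≠ 0 := by rintro rfl; norm_num at hτ
  refine (injective_iff_map_eq_zero _).2 fun q hq => ?_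
  simp only [zkCoord_apply, Prod.mk_eq_zero, mul_eq_zero, h3, false_or] at hq
  obtain ⟨h₁, h₂⟩ := hq
  have h1 : σ * q.1 = 0 := by linarith
  have h2 : τ * q.2 = 0 := by linarith
  exact Prod.ext ((mul_eq_zero.1 h1).resolve_left hσ') ((mul_eq_zero.1 h2).resolve_left hτ')

theorem zkDual_injective : Function.Injective zkDual := by
  have h3 : √3 ≠ 0 := by positivity
  refine (injective_iff_map_eq_zero _).2 fun z hz => ?_
  simp only [zkDual_apply, Prod.mk_eq_zero] at hz
  obtain ⟨h₀, h₁, h₂⟩ := hz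
  have h1 : √3 * z.2.2 = 0 := by linarith
  exact Prod.ext h₀ (Prod.ext (by simpa [h1] using h₁) ((mul_eq_zero.1 h1).resolve_left h3))

theorem zkPhase_zkCoord {σ τ : ℝ} (hσ : σ ^ 2 = 1) (hτ : τ ^ 2 = 1) (z : ℝ × ℝ × ℝ) (q : ℝ × ℝ) :
    zkPhase z (zkCoord σ τ q) = (zkDual z).2.1 * (σ * q.1) + (zkDual z).2.2 * (τ * q.2) +
      (zkDual z).1 * cubicPhase (4 * σ) (4 * τ) q := by
  have h3 : √3 ^ 2 = 3 := Real.sq_sqrt (by norm_num)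
  have hσ3 : σ ^ 3 = σ := by rw [pow_succ, hσ, one_mul]
  have hτ3 : τ ^ 3 = τ := by rw [pow_succ, hτ, one_mul]
  simp only [zkPhase, zkCoord_apply, zkDual_apply, cubicPhase, mul_pow, h3]
  linear_combination 4 * z.1 * q.1 ^ 3 * hσ3 + 4 * z.1 * q.2 ^ 3 * hτ3

theorem zkCoord_mem_zkSector {σ τ : ℝ} (hσ : σ ^ 2 = 1) (hτ : τ ^ 2 = 1) (q : ℝ × ℝ) :
    zkCoord σ τ q ∈ zkSector σ τ ↔ 0 < q.1 ∧ 0 < q.2 := by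
  have h3 : 0 < 2 * √3 := by positivity
  have h1 : σ * (√3 * (σ * q.1 + τ * q.2) + √3 * (σ * q.1 - τ * q.2)) = 2 * √3 * q.1 := by
    linear_combination 2 * √3 * q.1 * hσ
  have h2 : τ * (√3 * (σ * q.1 + τ * q.2) - √3 * (σ * q.1 - τ * q.2)) = 2 * √3 * q.2 := by
    linear_combination 2 * √3 * q.2 * hτ
  simp only [zkSector, zkCoord_apply, Set.mem_ofPred_eq, h1, h2, mul_pos_iff_of_pos_left h3]

theorem zkWeighted_zkCoord {σ τ : ℝ} (hσ : σ ^ 2 = 1) (hτ : τ ^ 2 = 1) (w : ℝ × ℝ → ℂ)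
    (q : ℝ × ℝ) :
    zkWeighted w (zkCoord σ τ q) = (((12 : ℝ) ^ ((1 : ℝ) / 8) : ℝ) : ℂ) *
      (((|q.1 * q.2| ^ ((1 : ℝ) / 8) : ℝ) : ℂ) * w (zkCoord σ τ q)) := by
  have h3 : √3 ^ 2 = 3 := Real.sq_sqrt (by norm_num)
  have : |3 * (zkCoord σ τ q).1 ^ 2 - (zkCoord σ τ q).2 ^ 2| = 12 * |q.1 * q.2| := by
    have hs : |σ * τ| = 1 := by
      rw [← sq_eq_sq₀ (abs_nonneg _) zero_le_one, sq_abs, mul_pow, hσ, hτ]; norm_num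
    have : 3 * (zkCoord σ τ q).1 ^ 2 - (zkCoord σ τ q).2 ^ 2 = 12 * ((σ * τ) * (q.1 * q.2)) := by
      simp only [zkCoord_apply, mul_pow, h3]; ring
    rw [this, abs_mul, abs_mul (σ * τ), hs, one_mul, abs_of_pos (by norm_num : (0 : ℝ) < 12)]
  rw [zkWeighted, this, Real.mul_rpow (by norm_num) (abs_nonneg _), Complex.ofReal_mul, mul_assoc]

theorem exists_eLpNorm_zkSector_le {σ τ : ℝ} (hσ : σ ^ 2 = 1) (hτ : τ ^ 2 = 1) :
    ∃ C : NNReal, ∀ w : ℝ × ℝ → ℂ, Measurable w → Integrable (zkWeighted w) →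
      eLpNorm (fun z : ℝ × ℝ × ℝ => ∫ p : ℝ × ℝ, Complex.exp (Complex.I * zkPhase z p) *
        (zkSector σ τ).indicator (zkWeighted w) p) 4 volume ≤ C * eLpNorm w 2 volume := by
  have hσ' : σ ≠ 0 := by rintro rfl; norm_num at hσ
  have hτ' : τ ≠ 0 := by rintro rfl; norm_num at hτ
  obtain ⟨c, hc, hcl, hci, hcI⟩ :=
    exists_linear_changeOfVariables (zkCoord σ τ) (zkCoord_injective hσ hτ)
  have : (volume : Measure (ℝ × ℝ × ℝ)).IsAddHaarMeasure :=
    Measure.prod.instIsAddHaarMeasure volume volume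
  obtain ⟨d, hd, hdl, -, -⟩ := exists_linear_changeOfVariables zkDual zkDual_injective
  set κ : ℝ := (12 : ℝ) ^ ((1 : ℝ) / 8) with hκ
  have hκ0 : 0 < κ := by positivity
  obtain ⟨B, hB, hB0⟩ : ∃ B : ENNReal, B ≠ ⊤ ∧ B = ENNReal.ofReal (2 * Real.pi / |σ|) *
      ENNReal.ofReal (2 * Real.pi / |τ|) * (2 * (6 * ENNReal.ofReal (√(4 / |4 * σ * (4 * τ)|)) *
        ENNReal.ofReal (2 * Real.pi))) := by
    refine ⟨_, ?_, rfl⟩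
    finiteness
  set A : ENNReal := ‖(κ / c : ℝ)‖ₑ ^ 4 * (ENNReal.ofReal d * (B * ENNReal.ofReal c ^ 2)) with hA
  have hA_top : A ≠ ⊤ := by
    rw [hA]; finiteness
  refine ⟨(1 + A).toNNReal, fun w hw hk => ?_⟩
  rw [ENNReal.coe_toNNReal (by finiteness)]
  set D : Set (ℝ × ℝ) := {q | 0 < q.1 ∧ 0 < q.2} with hD
  have mD : MeasurableSet D := (measurableSet_lt measurable_const measurable_fst).inter
    (measurableSet_lt measurable_const measurable_snd)
  have mL : Measurable (zkCoord σ τ) := (zkCoord σ τ).continuous_of_finiteDimensional.measurable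
  set G : ℝ × ℝ → ℂ := D.indicator fun q => w (zkCoord σ τ q) with hG
  have mG : Measurable G := (hw.comp mL).indicator mD
  have hind : ∀ q, (zkSector σ τ).indicator (zkWeighted w) (zkCoord σ τ q) =
      (κ : ℂ) * (((|q.1 * q.2| ^ ((1 : ℝ) / 8) : ℝ) : ℂ) * G q) := by
    intro q
    by_cases hq : q ∈ D
    · rw [Set.indicator_of_mem ((zkCoord_mem_zkSector hσ hτ q).2 hq), zkWeighted_zkCoord hσ hτ,
        hG, Set.indicator_of_mem hq]
    · rw [Set.indicator_of_notMem (fun h => hq ((zkCoord_mem_zkSector hσ hτ q).1 h)),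
        hG, Set.indicator_of_notMem hq, mul_zero, mul_zero]
  have hkG : Integrable fun q : ℝ × ℝ => ((|q.1 * q.2| ^ ((1 : ℝ) / 8) : ℝ) : ℂ) * G q := by
    have h := (hcI _ (hk.indicator (measurableSet_zkSector σ τ))).const_mul ((κ : ℂ)⁻¹)
    refine h.congr (Filter.Eventually.of_forall fun q => ?_)
    simp only [hind]
    rw [inv_mul_cancel_left₀ (by exact_mod_cast hκ0.ne')]
  have hM := lintegral_extension_pow_four_le hσ' hτ' (mul_ne_zero four_ne_zero hσ')
    (mul_ne_zero four_ne_zero hτ') mG (fun q hq => (Set.mem_of_indicator_ne_zero hq : q ∈ D)) hkG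
  obtain ⟨T, hT⟩ : ∃ T : ℝ × ℝ × ℝ → ℂ, ∀ z, T z = ∫ p : ℝ × ℝ, Complex.exp (Complex.I *
      (z.2.1 * (σ * p.1) + z.2.2 * (τ * p.2) + z.1 * cubicPhase (4 * σ) (4 * τ) p : ℝ)) *
          (((|p.1 * p.2| ^ ((1 : ℝ) / 8) : ℝ) : ℂ) * G p) := ⟨_, fun _ => rfl⟩
  simp only [← hT] at hM
  have hF : ∀ z, ∫ p : ℝ × ℝ, Complex.exp (Complex.I * zkPhase z p) *
      (zkSector σ τ).indicator (zkWeighted w) p = ((κ / c : ℝ) : ℂ) * T (zkDual z) := by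
    intro z
    have h := hci fun p => Complex.exp (Complex.I * zkPhase z p) *
      (zkSector σ τ).indicator (zkWeighted w) p
    simp only [hind, zkPhase_zkCoord hσ hτ, mul_left_comm _ (κ : ℂ)] at h
    rw [integral_const_mul, ← hT, Complex.real_smul] at h
    have hc' : (c : ℂ) ≠ 0 := by exact_mod_cast hc.ne'
    rw [Complex.ofReal_div, div_mul_eq_mul_div, h, mul_div_cancel_left₀ _ hc']
  have hGw : ∫⁻ q, ‖G q‖ₑ ^ 2 ≤ ENNReal.ofReal c * ∫⁻ p, ‖w p‖ₑ ^ 2 := by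
    rw [← hcl]
    refine lintegral_mono fun q => ?_
    gcongr
    exact enorm_indicator_le_enorm_self _ _
  have hT4 : ∫⁻ z, ‖T z‖ₑ ^ 4 ≤ B * (∫⁻ q, ‖G q‖ₑ ^ 2) ^ 2 := by
    refine hM.trans (le_of_eq ?_)
    rw [hB0]; ring
  have hw2 : eLpNorm w 2 volume ^ 2 = ∫⁻ p, ‖w p‖ₑ ^ 2 := by
    simpa using eLpNorm_nnreal_pow_eq_lintegral (p := 2) (f := w) (μ := volume) two_ne_zero
  simp only [hF]
  have key : eLpNorm (fun z => ((κ / c : ℝ) : ℂ) * T (zkDual z)) 4 volume ^ 4 ≤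
      A * eLpNorm w 2 volume ^ 4 := by
    have h4 : eLpNorm (fun z => ((κ / c : ℝ) : ℂ) * T (zkDual z)) 4 volume ^ 4 =
        ∫⁻ z, ‖((κ / c : ℝ) : ℂ) * T (zkDual z)‖ₑ ^ 4 := by
      have := eLpNorm_nnreal_pow_eq_lintegral (p := 4) (μ := volume)
        (f := fun z => ((κ / c : ℝ) : ℂ) * T (zkDual z)) four_ne_zero
      rw [show ((4 : NNReal) : ℝ) = (4 : ℕ) by norm_num] at this
      simpa only [ENNReal.rpow_natCast, ENNReal.coe_ofNat] using this
    have hn : ‖((κ / c : ℝ) : ℂ)‖ₑ = ‖(κ / c : ℝ)‖ₑ := by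
      rw [← ofReal_norm, Complex.norm_real, ofReal_norm]
    rw [h4]
    simp only [enorm_mul, mul_pow]
    rw [lintegral_const_mul' _ _ (by finiteness), hdl fun z => ‖T z‖ₑ ^ 4, hn,
      show eLpNorm w 2 volume ^ 4 = (eLpNorm w 2 volume ^ 2) ^ 2 by rw [← pow_mul], hw2, hA]
    calc _ ≤ ‖(κ / c : ℝ)‖ₑ ^ 4 * (ENNReal.ofReal d *
          (B * (ENNReal.ofReal c * ∫⁻ p, ‖w p‖ₑ ^ 2) ^ 2)) := by
          gcongr
          exact hT4.trans (by gcongr)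
      _ = _ := by ring
  rw [← ENNReal.pow_le_pow_left_iff four_ne_zero, mul_pow]
  refine key.trans ?_
  gcongr
  calc A ≤ 1 + A := le_add_self
    _ ≤ (1 + A) ^ 4 := le_self_pow₀ (le_self_add) four_ne_zero

theorem stronglyMeasurable_integral_exp_zkPhase {k : ℝ × ℝ → ℂ} (hk : Measurable k) :
    StronglyMeasurable fun z : ℝ × ℝ × ℝ =>
      ∫ p : ℝ × ℝ, Complex.exp (Complex.I * zkPhase z p) * k p := by
  have hφ : Measurable fun y : (ℝ × ℝ × ℝ) × (ℝ × ℝ) => zkPhase y.1 y.2 := measurable_zkPhase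
  have : Measurable fun y : (ℝ × ℝ × ℝ) × (ℝ × ℝ) =>
      Complex.exp (Complex.I * zkPhase y.1 y.2) * k y.2 := by fun_prop
  exact this.stronglyMeasurable.integral_prod_right'

theorem zkWeighted_eq_sum_indicator (w : ℝ × ℝ → ℂ) (p : ℝ × ℝ) :
    zkWeighted w p = ∑ s : ℤˣ × ℤˣ, (zkSector (s.1 : ℤ) (s.2 : ℤ)).indicator (zkWeighted w) p := by
  have hz : (√3 * p.1 + p.2) * (√3 * p.1 - p.2) = 0 → zkWeighted w p = 0 := by
    intro h
    have h3 : √3 ^ 2 = 3 := Real.sq_sqrt (by norm_num)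
    have : 3 * p.1 ^ 2 - p.2 ^ 2 = 0 := by rw [← h]; linear_combination -p.1 ^ 2 * h3
    rw [zkWeighted, this, abs_zero, Real.zero_rpow (by norm_num), Complex.ofReal_zero, zero_mul]
  have huniv : (Finset.univ : Finset ℤˣ) = {1, -1} := rfl
  simp only [Fintype.sum_prod_type, huniv, Finset.sum_pair (show (1 : ℤˣ) ≠ -1 by decide),
    Set.indicator_apply, zkSector, Set.mem_ofPred_eq, Units.val_one, Units.val_neg, Int.cast_one,
    Int.cast_neg, one_mul, neg_mul, Left.neg_pos_iff]
  generalize √3 * p.1 + p.2 = a at hz ⊢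
  generalize √3 * p.1 - p.2 = b at hz ⊢
  rcases lt_trichotomy a 0 with ha | ha | ha
  · rcases lt_trichotomy b 0 with hb | hb | hb
    · simp [ha, hb, ha.not_gt, hb.not_gt]
    · simp [hz (by simp [hb])]
    · simp [ha, hb, ha.not_gt, hb.not_gt]
  · simp [hz (by simp [ha])]
  · rcases lt_trichotomy b 0 with hb | hb | hb
    · simp [ha, hb, ha.not_gt, hb.not_gt]
    · simp [hz (by simp [hb])]
    · simp [ha, hb, ha.not_gt, hb.not_gt]

theorem exists_eLpNorm_zkExtension_le :
    ∃ C : NNReal, ∀ w : ℝ × ℝ → ℂ, Measurable w →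
      eLpNorm (fun z : ℝ × ℝ × ℝ => ∫ p : ℝ × ℝ, Complex.exp (Complex.I * zkPhase z p) *
        zkWeighted w p) 4 volume ≤ C * eLpNorm w 2 volume := by
  have hs : ∀ s : ℤˣ, ((s : ℤ) : ℝ) ^ 2 = 1 := fun s => by
    rcases Int.units_eq_one_or s with rfl | rfl <;> norm_num
  choose C hC using fun s : ℤˣ × ℤˣ => exists_eLpNorm_zkSector_le (hs s.1) (hs s.2)
  refine ⟨∑ s, C s, fun w hw => ?_⟩
  have mφ : ∀ z, Measurable (zkPhase z) := fun z => measurable_zkPhase.of_uncurry_left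
  by_cases hk : Integrable (zkWeighted w)
  · have hsum : (fun z : ℝ × ℝ × ℝ => ∫ p : ℝ × ℝ, Complex.exp (Complex.I * zkPhase z p) *
        zkWeighted w p) = ∑ s : ℤˣ × ℤˣ, fun z : ℝ × ℝ × ℝ => ∫ p : ℝ × ℝ,
          Complex.exp (Complex.I * zkPhase z p) *
            (zkSector (s.1 : ℤ) (s.2 : ℤ)).indicator (zkWeighted w) p := by
      ext z
      rw [Finset.sum_apply, ← integral_finsetSum]
      · simp only [← Finset.mul_sum, ← zkWeighted_eq_sum_indicator]
      · exact fun s _ => integrable_exp_mul (mφ z) (hk.indicator (measurableSet_zkSector _ _))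
    rw [hsum]
    refine (eLpNorm_sum_le (fun s _ => (stronglyMeasurable_integral_exp_zkPhase
      ((measurable_zkWeighted hw).indicator
        (measurableSet_zkSector _ _))).aestronglyMeasurable) (by norm_num)).trans ?_
    rw [ENNReal.ofNNReal_finsetSum, Finset.sum_mul]
    exact Finset.sum_le_sum fun s _ => hC s w hw hk
  · have hzero : (fun z : ℝ × ℝ × ℝ => ∫ p : ℝ × ℝ, Complex.exp (Complex.I * zkPhase z p) *
        zkWeighted w p) = 0 := by
      ext z
      refine integral_undef fun h => hk ?_
      refine (integrable_exp_mul (mφ z).neg h).congr (Filter.Eventually.of_forall fun p => ?_)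
      simp only [Pi.neg_apply, Complex.ofReal_neg]
      rw [← mul_assoc, ← Complex.exp_add, mul_neg, neg_add_cancel, Complex.exp_zero, one_mul]
    rw [hzero, eLpNorm_zero]
    exact zero_le

theorem measurable_ftn2 {u : ℝ × ℝ → ℂ} (hu : Measurable u) : Measurable (ftn2 u) := by
  have : Measurable fun y : (ℝ × ℝ) × (ℝ × ℝ) =>
      Complex.exp (-(Complex.I * (y.2.1 * y.1.1 + y.2.2 * y.1.2))) * u y.2 := by fun_prop
  exact this.stronglyMeasurable.integral_prod_right'.measurable

theorem eLpNorm_ftn2_le {u : ℝ × ℝ → ℂ} (hu : Integrable u) :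
    eLpNorm (ftn2 u) 2 volume ≤ ENNReal.ofReal (2 * Real.pi) * eLpNorm u 2 volume := by
  have hsq : ∀ f : ℝ × ℝ → ℂ, eLpNorm f 2 volume ^ 2 = ∫⁻ p, ‖f p‖ₑ ^ 2 := fun f => by
    simpa using eLpNorm_nnreal_pow_eq_lintegral (p := 2) (f := f) (μ := volume) two_ne_zero
  have h := lintegral_enorm_fourier_sq_le (neg_ne_zero.2 one_ne_zero) (neg_ne_zero.2 one_ne_zero) hu
  rw [← ENNReal.pow_le_pow_left_iff two_ne_zero, mul_pow, hsq, hsq]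
  rw [abs_neg, abs_one, div_one, ← sq] at h
  refine le_trans (le_of_eq ?_) h
  refine lintegral_congr fun p => ?_
  congr 2
  refine integral_congr_ae (Filter.Eventually.of_forall fun q => ?_)
  dsimp only
  congr 2
  push_cast
  ring

theorem stmt13 :
    ∃ C : ℝ, 0 < C ∧
      ∀ u₀ : SchwartzMap (ℝ × ℝ) ℂ,
        eLpNorm
            (fun z : ℝ × ℝ × ℝ =>
              ((((2 * Real.pi) ^ 2)⁻¹ : ℝ) : ℂ) *
                ∫ p : ℝ × ℝ,
                  Complex.exp (Complex.I *
                      (z.2.1 * p.1 + z.2.2 * p.2 +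
                        z.1 * (p.1 * (p.1 ^ 2 + p.2 ^ 2)))) *
                    ((|3 * p.1 ^ 2 - p.2 ^ 2| ^ ((1 : ℝ) / 8) : ℝ) : ℂ) *
                    ftn2 (⇑u₀) p) 4 volume ≤
          ENNReal.ofReal C * eLpNorm (⇑u₀) 2 volume := by
  obtain ⟨C, hC⟩ := exists_eLpNorm_zkExtension_le
  set a : NNReal := ‖((((2 * Real.pi) ^ 2)⁻¹ : ℝ) : ℂ)‖₊ with ha
  set b : NNReal := Real.toNNReal (2 * Real.pi) with hb
  refine ⟨(a * (C * b) : NNReal) + 1, by positivity, fun u₀ => ?_⟩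
  have hF : (fun z : ℝ × ℝ × ℝ => ((((2 * Real.pi) ^ 2)⁻¹ : ℝ) : ℂ) *
      ∫ p : ℝ × ℝ, Complex.exp (Complex.I * (z.2.1 * p.1 + z.2.2 * p.2 +
        z.1 * (p.1 * (p.1 ^ 2 + p.2 ^ 2)))) *
          ((|3 * p.1 ^ 2 - p.2 ^ 2| ^ ((1 : ℝ) / 8) : ℝ) : ℂ) * ftn2 (⇑u₀) p) =
      ((((2 * Real.pi) ^ 2)⁻¹ : ℝ) : ℂ) • fun z : ℝ × ℝ × ℝ => ∫ p : ℝ × ℝ,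
        Complex.exp (Complex.I * zkPhase z p) * zkWeighted (ftn2 u₀) p := by
    ext z
    rw [Pi.smul_apply, smul_eq_mul]
    congr 1
    refine integral_congr_ae (Filter.Eventually.of_forall fun p => ?_)
    simp only [zkPhase, zkWeighted, mul_assoc]
    push_cast
    ring_nf
  rw [hF, eLpNorm_const_smul]
  calc ‖((((2 * Real.pi) ^ 2)⁻¹ : ℝ) : ℂ)‖ₑ * _
      ≤ a * (C * (b * eLpNorm u₀ 2 volume)) := by
        gcongr
        · exact le_rfl
        · exact (hC _ (measurable_ftn2 u₀.continuous.measurable)).trans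
            (mul_le_mul_right (eLpNorm_ftn2_le u₀.integrable) _)
    _ = (a * (C * b) : NNReal) * eLpNorm u₀ 2 volume := by push_cast; ring
    _ ≤ _ := by
        gcongr
        rw [ENNReal.ofReal_add (NNReal.coe_nonneg _) zero_le_one, ENNReal.ofReal_coe_nnreal]
        exact le_self_add
end
end
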